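/- arXiv:2602.02302 — 3 statements merged into one kernel-verified Lean document; each statement's English description precedes it below -/
import Mathlib

section
/- Let Ω be a countably infinite set, let M be a topologically closed submonoid of Ω^Ω, and let G := {g ∈ M : g is a bijection and g⁻¹ ∈ M}. Assume G is oligomorphic and acts without algebraicity. Let U ⊆ Ω^n be M-invariant and let ∼ be an M-invariant equivalence relation on U; assume B := U/∼ is dense and the induced action of G on B is without algebraicity. If additionally the finite-to-one elements of M are dense in M (in the topology of pointwise convergence), then the entanglement relation is preserved by every e ∈ M: if a ∈ Ω entangles the class u/∼ of u ∈ U, then e(a) entangles the class (e∘u)/∼. -/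
/-- The topology of pointwise convergence on functions `α → β`
(product topology with `β` discrete). -/
def FnTop (α β : Type*) : TopologicalSpace (α → β) :=
  @Pi.topologicalSpace α (fun _ => β) (fun _ => ⊥)

/-- The coordinatewise action of a permutation on tuples. -/
def tAct {Ω : Type*} (g : Equiv.Perm Ω) {n : ℕ} (u : Fin n → Ω) : Fin n → Ω :=
  fun i => g (u i)

/-- The action of a permutation on sets of tuples. -/
def sAct {Ω : Type*} (g : Equiv.Perm Ω) {n : ℕ} (c : Set (Fin n → Ω)) : Set (Fin n → Ω) :=
  tAct g '' c

/-- A set of permutations is oligomorphic if for every `n` its coordinatewise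
action on `n`-tuples has finitely many orbits. -/
def Oligo {Ω : Type*} (G : Set (Equiv.Perm Ω)) : Prop :=
  ∀ n : ℕ, Set.Finite {o : Set (Fin n → Ω) | ∃ t : Fin n → Ω, o = {s | ∃ g ∈ G, s = tAct g t}}

/-- `G` acts without algebraicity on `Ω`: if the orbit of `a` under the pointwise
stabiliser of a finite tuple `y` is finite, then `a` is an entry of `y`. -/
def NoAlg {Ω : Type*} (G : Set (Equiv.Perm Ω)) : Prop :=
  ∀ (m : ℕ) (y : Fin m → Ω) (a : Ω),
    Set.Finite {b : Ω | ∃ g ∈ G, (∀ i, g (y i) = y i) ∧ b = g a} → ∃ i, a = y i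

/-- `G` is topologically closed in the space of permutations with the topology of
pointwise convergence. -/
def TopClosedPerm {Ω : Type*} (G : Set (Equiv.Perm Ω)) : Prop :=
  @IsClosed (Ω → Ω) (FnTop Ω Ω) {f | ∃ g ∈ G, f = ⇑g}

/-- The `r`-equivalence class of a tuple `u ∈ U`. -/
def cls {Ω : Type*} {n : ℕ} (U : Set (Fin n → Ω))
    (r : (Fin n → Ω) → (Fin n → Ω) → Prop) (u : Fin n → Ω) : Set (Fin n → Ω) :=
  {v ∈ U | r u v}

/-- The quotient `B = U/∼`, realised as the set of equivalence classes. -/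
def classes {Ω : Type*} {n : ℕ} (U : Set (Fin n → Ω))
    (r : (Fin n → Ω) → (Fin n → Ω) → Prop) : Set (Set (Fin n → Ω)) :=
  {c | ∃ u ∈ U, c = cls U r u}

/-- `a` entangles the class `c` if `a` is an entry of every tuple in `c`. -/
def Entangles {Ω : Type*} {n : ℕ} (a : Ω) (c : Set (Fin n → Ω)) : Prop :=
  ∀ v ∈ c, ∃ i, v i = a

/-- `a` strongly entangles `c ∈ B` if it entangles `c` and no other element of `B`. -/
def StronglyEntangles {Ω : Type*} {n : ℕ} (B : Set (Set (Fin n → Ω))) (a : Ω)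
    (c : Set (Fin n → Ω)) : Prop :=
  Entangles a c ∧ ∀ c' ∈ B, Entangles a c' → c' = c

/-- `a` is algebraic over `c`: the orbit of `a` under the stabiliser `G_c` is finite. -/
def AlgebraicOver {Ω : Type*} {n : ℕ} (G : Set (Equiv.Perm Ω)) (a : Ω)
    (c : Set (Fin n → Ω)) : Prop :=
  Set.Finite {b : Ω | ∃ g ∈ G, sAct g c = c ∧ b = g a}

/-- `B` is dense: for every `a ∈ Ω` there are `c₁,…,c_k ∈ B` whose joint stabiliser
is contained in the stabiliser of `a`. -/
def DenseClasses {Ω : Type*} {n : ℕ} (G : Set (Equiv.Perm Ω))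
    (B : Set (Set (Fin n → Ω))) : Prop :=
  ∀ a : Ω, ∃ (k : ℕ) (cc : Fin k → Set (Fin n → Ω)),
    (∀ i, cc i ∈ B) ∧ ∀ g ∈ G, (∀ i, sAct g (cc i) = cc i) → g a = a

/-- The induced action of `G` on `B` is without algebraicity. -/
def NoAlgOn {Ω : Type*} {n : ℕ} (G : Set (Equiv.Perm Ω))
    (B : Set (Set (Fin n → Ω))) : Prop :=
  ∀ (m : ℕ) (cc : Fin m → Set (Fin n → Ω)) (c : Set (Fin n → Ω)),
    (∀ i, cc i ∈ B) → c ∈ B →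
    Set.Finite {c' | ∃ g ∈ G, (∀ i, sAct g (cc i) = cc i) ∧ c' = sAct g c} →
    ∃ i, c = cc i

/-- The topology of pointwise convergence on `Function.End Ω`. -/
def endTop (Ω : Type*) : TopologicalSpace (Function.End Ω) := FnTop Ω Ω

/-- The unit group of a submonoid `M` of `Ω^Ω`: bijective elements of `M`
whose inverse also belongs to `M`, viewed as permutations. -/
def unitSet {Ω : Type*} (M : Submonoid (Function.End Ω)) : Set (Equiv.Perm Ω) :=
  {g | (⇑g : Function.End Ω) ∈ M ∧ (⇑g.symm : Function.End Ω) ∈ M}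

/-- A function is finite-to-one if every point has finite preimage. -/
def FinToOne {Ω : Type*} (e : Ω → Ω) : Prop :=
  ∀ b : Ω, Set.Finite {x | e x = b}

open scoped Pointwise in
theorem ent_neumann {K X : Type*} [Group K] [MulAction K X] (T F : Finset X)
    (hT : ∀ t ∈ T, (MulAction.orbit K t).Infinite) : ∃ k : K, ∀ t ∈ T, k • t ∉ F := by
  classical
  by_contra hcon
  push Not at hcon
  let s : Finset (X × X) := (T ×ˢ F).filter (fun p => ∃ k : K, k • p.1 = p.2)
  let g : X × X → K := fun p => if h : ∃ k : K, k • p.1 = p.2 then h.choose else 1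
  have hg : ∀ p : X × X, (∃ k : K, k • p.1 = p.2) → g p • p.1 = p.2 := by
    intro p h
    simp only [g, dif_pos h]
    exact h.choose_spec
  have hcov : ⋃ p ∈ s, g p • ((MulAction.stabilizer K p.1 : Subgroup K) : Set K) = Set.univ := by
    rw [Set.eq_univ_iff_forall]
    intro k
    obtain ⟨t, ht, hF⟩ := hcon k
    have hp : ∃ k' : K, k' • (t, k • t).1 = (t, k • t).2 := ⟨k, rfl⟩
    simp only [Set.mem_iUnion]
    refine ⟨(t, k • t), ?_, ?_⟩
    · simp only [s, Finset.mem_filter, Finset.mem_product]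
      exact ⟨⟨ht, hF⟩, hp⟩
    · rw [mem_leftCoset_iff]
      simp only [SetLike.mem_coe, MulAction.mem_stabilizer_iff, mul_smul]
      rw [inv_smul_eq_iff]
      exact (hg _ hp).symm
  obtain ⟨p, hp, hfi⟩ := Subgroup.exists_finiteIndex_of_leftCoset_cover hcov
  simp only [s, Finset.mem_filter, Finset.mem_product] at hp
  have : Finite (K ⧸ MulAction.stabilizer K p.1) := inferInstance
  have : Finite (MulAction.orbit K p.1) :=
    Finite.of_equiv _ (MulAction.orbitEquivQuotientStabilizer K p.1).symm
  exact hT p.1 hp.1.1 (Set.toFinite _)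

theorem ent_move {Ω : Type*} (G : Subgroup (Equiv.Perm Ω)) (hG : NoAlg (G : Set (Equiv.Perm Ω)))
    (a : Ω) (T F : Finset Ω) (hT : a ∉ T) :
    ∃ g ∈ G, g a = a ∧ ∀ t ∈ T, g t ∉ F := by
  obtain ⟨k, hk⟩ := ent_neumann (K := MulAction.stabilizer G a) T F (by
    intro t ht hfin
    obtain ⟨i, hi⟩ := hG 1 (fun _ => a) t (hfin.subset (by
      rintro b ⟨g, hg, hga, rfl⟩
      exact ⟨⟨⟨g, hg⟩, hga 0⟩, rfl⟩))
    exact hT (hi ▸ ht))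
  exact ⟨k.1.1, k.1.2, k.2, hk⟩

theorem ent_noalg_set {Ω : Type*} {G : Set (Equiv.Perm Ω)} (hG : NoAlg G)
    (Y : Set Ω) (hY : Y.Finite) (a : Ω)
    (h : Set.Finite {b : Ω | ∃ g ∈ G, (∀ y ∈ Y, g y = y) ∧ b = g a}) : a ∈ Y := by
  obtain ⟨m, f, hf⟩ := hY.fin_param
  obtain ⟨i, hi⟩ := hG m (fun i => f i) a (h.subset (by
    rintro b ⟨g, hg, hy, rfl⟩
    refine ⟨g, hg, fun y hyY => ?_, rfl⟩
    rw [← hf.2] at hyY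
    obtain ⟨i, rfl⟩ := hyY
    exact hy i))
  rw [hi, ← hf.2]
  exact ⟨i, rfl⟩

theorem ent_noalgOn_set {Ω : Type*} {n : ℕ} {G : Set (Equiv.Perm Ω)}
    {B : Set (Set (Fin n → Ω))} (hB : NoAlgOn G B)
    (D : Set (Set (Fin n → Ω))) (hD : D.Finite) (hDB : D ⊆ B) (c : Set (Fin n → Ω)) (hc : c ∈ B)
    (h : Set.Finite {c' | ∃ g ∈ G, (∀ d ∈ D, sAct g d = d) ∧ c' = sAct g c}) : c ∈ D := by
  obtain ⟨m, f, hf⟩ := hD.fin_param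
  obtain ⟨i, hi⟩ := hB m (fun i => f i) c (fun i => hDB (hf.2 ▸ ⟨i, rfl⟩)) hc (h.subset (by
    rintro b ⟨g, hg, hy, rfl⟩
    refine ⟨g, hg, fun y hyY => ?_, rfl⟩
    rw [← hf.2] at hyY
    obtain ⟨i, rfl⟩ := hyY
    exact hy i))
  rw [hi, ← hf.2]
  exact ⟨i, rfl⟩

theorem ent_dense_set {Ω : Type*} {n : ℕ} {G : Set (Equiv.Perm Ω)}
    {B : Set (Set (Fin n → Ω))} (hB : DenseClasses G B) (Y : Set Ω) (hY : Y.Finite) :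
    ∃ D : Set (Set (Fin n → Ω)), D.Finite ∧ D ⊆ B ∧
      ∀ g ∈ G, (∀ d ∈ D, sAct g d = d) → ∀ y ∈ Y, g y = y := by
  choose k cc h1 h2 using hB
  refine ⟨⋃ y ∈ Y, Set.range (cc y), hY.biUnion fun y _ => Set.finite_range _, ?_, ?_⟩
  · intro d hd
    simp only [Set.mem_iUnion] at hd
    obtain ⟨y, -, i, rfl⟩ := hd
    exact h1 y i
  · intro g hg h y hy
    refine h2 y g hg fun i => h _ ?_
    simp only [Set.mem_iUnion]
    exact ⟨y, hy, i, rfl⟩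

theorem ent_sAct {Ω : Type*} {n : ℕ} (g : Equiv.Perm Ω) {a : Ω} {c : Set (Fin n → Ω)}
    (h : Entangles a c) : Entangles (g a) (sAct g c) := by
  rintro _ ⟨v, hv, rfl⟩
  obtain ⟨i, hi⟩ := h v hv
  exact ⟨i, by simp [tAct, hi]⟩

theorem sAct_inj' {Ω : Type*} {n : ℕ} (g : Equiv.Perm Ω) {c c' : Set (Fin n → Ω)}
    (h : sAct g c = sAct g c') : c = c' := by
  refine Set.image_injective.2 ?_ h
  intro u v huv
  funext i
  exact g.injective (congrFun huv i)

/-- working hypotheses -/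
structure EntH {Ω : Type*} {n : ℕ} (G : Subgroup (Equiv.Perm Ω)) (U : Set (Fin n → Ω))
    (r : (Fin n → Ω) → (Fin n → Ω) → Prop) : Prop where
  hGnoalg : NoAlg (G : Set (Equiv.Perm Ω))
  hU : ∀ g ∈ G, ∀ u ∈ U, tAct g u ∈ U
  hrefl : ∀ u ∈ U, r u u
  hsymm : ∀ u ∈ U, ∀ v ∈ U, r u v → r v u
  htrans : ∀ u ∈ U, ∀ v ∈ U, ∀ w ∈ U, r u v → r v w → r u w
  hr : ∀ g ∈ G, ∀ u ∈ U, ∀ v ∈ U, r u v → r (tAct g u) (tAct g v)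
  hdense : DenseClasses (G : Set (Equiv.Perm Ω)) (classes U r)
  hB : NoAlgOn (G : Set (Equiv.Perm Ω)) (classes U r)

namespace EntH
variable {Ω : Type*} {n : ℕ} {G : Subgroup (Equiv.Perm Ω)} {U : Set (Fin n → Ω)}
    {r : (Fin n → Ω) → (Fin n → Ω) → Prop}

theorem sAct_cls (H : EntH G U r) {g : Equiv.Perm Ω} (hg : g ∈ G) {u : Fin n → Ω} (hu : u ∈ U) :
    sAct g (cls U r u) = cls U r (tAct g u) := by
  ext w
  constructor
  · rintro ⟨v, ⟨hv, hr⟩, rfl⟩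
    exact ⟨H.hU g hg v hv, H.hr g hg u hu v hv hr⟩
  · rintro ⟨hw, hr⟩
    have hi := G.inv_mem hg
    refine ⟨tAct g⁻¹ w, ⟨H.hU _ hi w hw, ?_⟩, by funext i; simp [tAct]⟩
    have := H.hr _ hi _ (H.hU g hg u hu) w hw hr
    have e : tAct g⁻¹ (tAct g u) = u := by funext i; simp [tAct]
    rwa [e] at this

theorem cls_eq (H : EntH G U r) {u v : Fin n → Ω} (hu : u ∈ U) (hv : v ∈ cls U r u) :
    cls U r v = cls U r u := by
  obtain ⟨hvU, huv⟩ := hv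
  ext w
  constructor
  · rintro ⟨hw, h⟩
    exact ⟨hw, H.htrans u hu v hvU w hw huv h⟩
  · rintro ⟨hw, h⟩
    exact ⟨hw, H.htrans v hvU u hu w hw (H.hsymm u hu v hvU huv) h⟩

theorem ne (H : EntH G U r) {c : Set (Fin n → Ω)} (hc : c ∈ classes U r) : c.Nonempty := by
  obtain ⟨u, hu, rfl⟩ := hc
  exact ⟨u, hu, H.hrefl u hu⟩

theorem fin_ent (H : EntH G U r) {c : Set (Fin n → Ω)} (hc : c ∈ classes U r) :
    {a | Entangles a c}.Finite := by
  obtain ⟨v, hv⟩ := H.ne hc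
  exact (Set.finite_range v).subset fun a ha => ha v hv

theorem mem_B (H : EntH G U r) {c : Set (Fin n → Ω)} (hc : c ∈ classes U r)
    {g : Equiv.Perm Ω} (hg : g ∈ G) : sAct g c ∈ classes U r := by
  obtain ⟨u, hu, rfl⟩ := hc
  exact ⟨_, H.hU g hg u hu, H.sAct_cls hg hu⟩

/-- step 1 -/
theorem uniq (H : EntH G U r) {a : Ω} {c c' : Set (Fin n → Ω)} (hc : c ∈ classes U r)
    (hc' : c' ∈ classes U r) (ha : Entangles a c) (ha' : Entangles a c') : c = c' := by
  classical
  obtain ⟨u, hu, rfl⟩ := id hc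
  let Y : Set Ω := {y | y ∈ Set.range u ∧ y ≠ a}
  have hY : Y.Finite := (Set.finite_range u).subset fun y hy => hy.1
  obtain ⟨D, hDf, hDB, hD⟩ := ent_dense_set H.hdense Y hY
  obtain ⟨g, hg, hgY, hgD⟩ : ∃ g ∈ G, (∀ y ∈ Y, g y = y) ∧ sAct g (cls U r u) ∉ D := by
    by_contra hcon
    push Not at hcon
    have : a ∈ Y := ent_noalg_set H.hGnoalg Y hY a
      ((hDf.biUnion (t := fun d => {a | Entangles a d}) fun d hd => H.fin_ent (hDB hd)).subset (by
        rintro b ⟨g, hg, hgY, rfl⟩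
        simp only [Set.mem_iUnion]
        exact ⟨_, hcon g hg hgY, ent_sAct g ha⟩))
    exact this.2 rfl
  have key := ent_noalgOn_set H.hB (insert (sAct g c') D) (hDf.insert _)
    (Set.insert_subset (H.mem_B hc' hg) hDB) (sAct g (cls U r u)) (H.mem_B hc hg)
    (((H.fin_ent (H.mem_B hc' hg)).image
      (fun t => cls U r (fun i => if u i = a then t else u i))).subset (by
      rintro _ ⟨h, hh, hfix, rfl⟩
      refine ⟨h (g a), ?_, ?_⟩
      · have := ent_sAct h (ent_sAct g ha')
        rwa [hfix _ (Set.mem_insert _ _)] at this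
      · rw [H.sAct_cls hg hu, H.sAct_cls hh (H.hU g hg u hu)]
        dsimp only
        congr 1
        funext i
        simp only [tAct]
        split_ifs with hi
        · rw [hi]
        · have hy : u i ∈ Y := ⟨⟨i, rfl⟩, hi⟩
          rw [hgY _ hy, hD h hh (fun d hd => hfix d (Set.mem_insert_of_mem _ hd)) _ hy]))
  rcases key with key | key
  · exact sAct_inj' g key
  · exact absurd key hgD

/-- step 2 -/
theorem exists_cls (H : EntH G U r) (x : Ω) : ∃ c ∈ classes U r, Entangles x c := by
  classical
  by_contra hcon
  push Not at hcon
  obtain ⟨D, hDf, hDB, hD⟩ := ent_dense_set H.hdense {x} (Set.finite_singleton x)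
  have : ∀ d : Set (Fin n → Ω), ∃ v : Fin n → Ω, d ∈ D → v ∈ d ∧ ∀ i, v i ≠ x := by
    intro d
    by_cases hd : d ∈ D
    · have := hcon d (hDB hd)
      simp only [Entangles] at this
      push Not at this
      obtain ⟨v, hv, h⟩ := this
      exact ⟨v, fun _ => ⟨hv, h⟩⟩
    · exact ⟨fun _ => x, fun h => absurd h hd⟩
  choose v hv using this
  have hx := ent_noalg_set H.hGnoalg (⋃ d ∈ D, Set.range (v d))
    (hDf.biUnion fun d _ => Set.finite_range _) x ((Set.finite_singleton x).subset (by
      rintro b ⟨g, hg, hfix, rfl⟩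
      refine hD g hg (fun d hd => ?_) x rfl
      obtain ⟨u, hu, hdu⟩ := hDB hd
      have hvd := (hv d hd).1
      have h1 : cls U r (v d) = d := by
        rw [hdu] at hvd ⊢
        exact H.cls_eq hu hvd
      have h2 : v d ∈ U := by
        rw [hdu] at hvd ⊢
        exact hvd.1
      have h3 : tAct g (v d) = v d := by
        funext i
        refine hfix _ ?_
        simp only [Set.mem_iUnion]
        exact ⟨d, hd, i, rfl⟩
      rw [← h1, H.sAct_cls hg h2, h3]))
  simp only [Set.mem_iUnion] at hx
  obtain ⟨d, hd, i, hi⟩ := hx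
  exact (hv d hd).2 i hi

/-- step 3 -/
theorem exists_ent (H : EntH G U r) {c : Set (Fin n → Ω)} (hc : c ∈ classes U r) :
    ∃ a, Entangles a c := by
  obtain ⟨v, hv, rfl⟩ := id hc
  choose f hf hfe using H.exists_cls
  obtain ⟨i, hi⟩ := ent_noalgOn_set H.hB (Set.range fun i => f (v i)) (Set.finite_range _)
    (by rintro _ ⟨i, rfl⟩; exact hf _) _ hc
    (((Set.Finite.pi' (t := fun i => {a | Entangles a (f (v i))})
      fun i => H.fin_ent (hf _)).image (cls U r)).subset (by
      rintro _ ⟨g, hg, hfix, rfl⟩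
      refine ⟨tAct g v, fun i => ?_, (H.sAct_cls hg hv).symm⟩
      have := ent_sAct g (hfe (v i))
      rwa [hfix _ ⟨i, rfl⟩] at this))
  exact ⟨v i, hi ▸ hfe (v i)⟩

end EntH

/-- the unit group -/
def entGrp {Ω : Type*} (M : Submonoid (Function.End Ω)) : Subgroup (Equiv.Perm Ω) where
  carrier := unitSet M
  mul_mem' := by
    rintro g h ⟨hg, hg'⟩ ⟨hh, hh'⟩
    have h1 := M.mul_mem hg hh
    have h2 := M.mul_mem hh' hg'
    exact ⟨h1, h2⟩
  one_mem' := ⟨M.one_mem, M.one_mem⟩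
  inv_mem' := by
    rintro g ⟨hg, hg'⟩
    exact ⟨hg', hg⟩

theorem ent_approx {Ω : Type*} (S : Set (Function.End Ω)) (e : Function.End Ω)
    (he : e ∈ @closure (Function.End Ω) (endTop Ω) S) {n : ℕ} (u : Fin n → Ω) :
    ∃ f ∈ S, ∀ i, f (u i) = e (u i) := by
  let _ : TopologicalSpace Ω := ⊥
  have _ : DiscreteTopology Ω := ⟨rfl⟩
  have he' : e ∈ @closure (Ω → Ω) Pi.topologicalSpace S := he
  have ho : IsOpen {f : Ω → Ω | ∀ i, f (u i) = e (u i)} := by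
    rw [Set.ofPred_forall]
    refine isOpen_iInter_of_finite fun i => ?_
    have hc : Continuous (fun f : Ω → Ω => f (u i)) := continuous_apply (u i)
    have ho : IsOpen ({e (u i)} : Set Ω) := isOpen_discrete _
    exact ho.preimage hc
  obtain ⟨f, hf, hfS⟩ := (@mem_closure_iff (Ω → Ω) _ e S).1 he' _ ho (fun i => rfl)
  exact ⟨f, hfS, hf⟩

theorem entanglement_preserved_by_endomorphisms
    {Ω : Type} [Countable Ω] [Infinite Ω]
    (M : Submonoid (Function.End Ω))
    (hMclosed : @IsClosed (Function.End Ω) (endTop Ω) (M : Set (Function.End Ω)))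
    (hGoligo : Oligo (unitSet M))
    (hGnoalg : NoAlg (unitSet M))
    {n : ℕ} (U : Set (Fin n → Ω))
    (hUinv : ∀ e ∈ M, ∀ u ∈ U, (fun i => e (u i)) ∈ U)
    (r : (Fin n → Ω) → (Fin n → Ω) → Prop)
    (hrefl : ∀ u ∈ U, r u u)
    (hsymm : ∀ u ∈ U, ∀ v ∈ U, r u v → r v u)
    (htrans : ∀ u ∈ U, ∀ v ∈ U, ∀ w ∈ U, r u v → r v w → r u w)
    (hrinv : ∀ e ∈ M, ∀ u ∈ U, ∀ v ∈ U, r u v → r (fun i => e (u i)) (fun i => e (v i)))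
    (hdense : DenseClasses (unitSet M) (classes U r))
    (hBnoalg : NoAlgOn (unitSet M) (classes U r))
    (hftodense : (M : Set (Function.End Ω)) ⊆
      @closure (Function.End Ω) (endTop Ω) {e | e ∈ M ∧ FinToOne e})
    :
    ∀ e ∈ M, ∀ (a : Ω), ∀ u ∈ U,
      Entangles a (cls U r u) → Entangles (e a) (cls U r (fun i => e (u i))) := by
  classical
  have H : EntH (entGrp M) U r :=
    { hGnoalg := hGnoalg
      hU := fun g hg u hu => hUinv _ hg.1 u hu
      hrefl := hrefl
      hsymm := hsymm
      htrans := htrans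
      hr := fun g hg u hu v hv h => hrinv _ hg.1 u hu v hv h
      hdense := hdense
      hB := hBnoalg }
  intro e he a u hu ha
  obtain ⟨f, ⟨hfM, hff⟩, hfe⟩ := ent_approx _ e (hftodense he) u
  obtain ⟨j, hj⟩ := ha u ⟨hu, hrefl u hu⟩
  have h1 : (fun i => e (u i)) = fun i => f (u i) := funext fun i => (hfe i).symm
  have h2 : e a = f a := by rw [← hj]; exact (hfe j).symm
  rw [h1, h2]
  have hfu := hUinv f hfM u hu
  obtain ⟨b, hb⟩ := H.exists_ent ⟨_, hfu, rfl⟩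
  suffices b = f a by rwa [this] at hb
  by_contra hne
  obtain ⟨g, hg, hga, hgT⟩ := ent_move (entGrp M) hGnoalg a
    ((Finset.univ.image u).erase a) (hff b).toFinset (by simp)
  have hcu : cls U r u ∈ classes U r := ⟨u, hu, rfl⟩
  have hgc : sAct g (cls U r u) = cls U r u := by
    have := ent_sAct g ha
    rw [hga] at this
    exact H.uniq (H.mem_B hcu hg) hcu this ha
  have hgu : tAct g u ∈ cls U r u := by
    rw [← hgc]
    exact ⟨u, ⟨hu, hrefl u hu⟩, rfl⟩
  obtain ⟨i, hi⟩ := hb (fun i => f (tAct g u i))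
    ⟨hUinv f hfM _ hgu.1, hrinv f hfM u hu _ hgu.1 hgu.2⟩
  by_cases hia : u i = a
  · simp only [tAct, hia, hga] at hi
    exact hne hi.symm
  · exact hgT (u i) (by simp [hia]) ((hff b).mem_toFinset.2 hi)
end

section
/- Let Ω and Ω′ be countably infinite sets and let M ⊆ Ω^Ω and N ⊆ Ω′^Ω′ be topologically closed submonoids whose unit groups G(M) := {g ∈ M : g bijective, g⁻¹ ∈ M} and G(N) := {g ∈ N : g bijective, g⁻¹ ∈ N} are oligomorphic and act without algebraicity (so that M and N are the endomorphism monoids of ω-categorical structures without algebraicity). Assume moreover that the finite-to-one elements of M are dense in M. Then every topological monoid isomorphism φ: M → N (a monoid isomorphism that is a homeomorphism with respect to the topologies of pointwise convergence) is an isomorphism of transformation monoid actions: there exists a bijection θ: Ω → Ω′ such that φ(e) = θ∘e∘θ⁻¹ for all e ∈ M. -/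
/-- The subspace topology of pointwise convergence on a submonoid of `Ω^Ω`. -/
def subTopM {Ω : Type*} (M : Submonoid (Function.End Ω)) : TopologicalSpace M :=
  TopologicalSpace.induced Subtype.val (endTop Ω)

namespace TopMonIso

section grp
variable {K X Y : Type*} [Group K]

def NA (ρ : K →* Equiv.Perm X) : Prop :=
  ∀ (s : Finset X) (a : X), Set.Finite {b | ∃ g : K, (∀ x ∈ s, ρ g x = x) ∧ b = ρ g a} → a ∈ s

def Supp (ρ : K →* Equiv.Perm X) (σ : K →* Equiv.Perm Y) : Prop :=
  ∀ b : Y, ∃ s : Finset X, ∀ g : K, (∀ x ∈ s, ρ g x = x) → σ g b = b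

def R (ρ : K →* Equiv.Perm X) (σ : K →* Equiv.Perm Y) (a : X) (b : Y) : Prop :=
  Set.Finite {x | ∃ g : K, σ g b = b ∧ x = ρ g a}

theorem inv_fix (ρ : K →* Equiv.Perm X) {g : K} {a c : X} (h : ρ g a = c) : ρ g⁻¹ c = a := by
  subst h; simp

theorem step1 (ρ : K →* Equiv.Perm X) (σ : K →* Equiv.Perm Y) (hY : NA σ)
    {a : X} {b b' : Y} (h : R ρ σ a b) (h' : R σ ρ b' a) : b' = b := by
  have : b' ∈ ({b} : Finset Y) := by
    apply hY
    have key : ∀ c : X, ∃ k : K, (∃ g : K, σ g b = b ∧ c = ρ g a) → σ k b = b ∧ c = ρ k a := by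
      intro c
      by_cases hc : ∃ g : K, σ g b = b ∧ c = ρ g a
      · obtain ⟨g, hg⟩ := hc
        exact ⟨g, fun _ => hg⟩
      · exact ⟨1, fun h => absurd h hc⟩
    choose k hk using key
    refine Set.Finite.subset (h.biUnion (fun c _ => h'.image (σ (k c)))) ?_
    rintro y ⟨g, hg, rfl⟩
    have hgb := hg b (by simp)
    have hc := hk (ρ g a) ⟨g, hgb, rfl⟩
    simp only [Set.mem_iUnion]
    refine ⟨ρ g a, ⟨g, hgb, rfl⟩, σ ((k (ρ g a))⁻¹ * g) b', ⟨_, ?_, rfl⟩, ?_⟩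
    · rw [map_mul, Equiv.Perm.mul_apply]
      exact inv_fix ρ hc.2.symm
    · rw [← Equiv.Perm.mul_apply, ← map_mul]; simp
  simpa using this

theorem step2 (ρ : K →* Equiv.Perm X) (σ : K →* Equiv.Perm Y) (hX : NA ρ)
    (h1 : Supp ρ σ) (h2 : Supp σ ρ) (a : X) : ∃ b, R ρ σ a b := by
  classical
  by_contra hcon
  push Not at hcon
  obtain ⟨t, ht⟩ := h2 a
  have key : ∀ b : Y, ∃ s : Finset X, a ∉ s ∧ ∀ g : K, (∀ x ∈ s, ρ g x = x) → σ g b = b := by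
    intro b
    obtain ⟨s, hs⟩ := h1 b
    have hinf : ¬ {x | ∃ g : K, σ g b = b ∧ x = ρ g a} ⊆ (s : Set X) := fun hsub =>
      hcon b (s.finite_toSet.subset hsub)
    rw [Set.not_subset] at hinf
    obtain ⟨_, ⟨g, hg, rfl⟩, hn⟩ := hinf
    refine ⟨s.image (ρ g⁻¹), ?_, ?_⟩
    · intro hm
      obtain ⟨x, hx, hxa⟩ := Finset.mem_image.1 hm
      apply hn
      rw [← hxa, ← Equiv.Perm.mul_apply, ← map_mul]
      simpa using hx
    · intro k hk
      have := hs (g * k * g⁻¹) (by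
        intro x hx
        have := hk (ρ g⁻¹ x) (Finset.mem_image_of_mem _ hx)
        simp only [map_mul, Equiv.Perm.mul_apply, this]
        simp)
      simp only [map_mul, Equiv.Perm.mul_apply, inv_fix σ hg] at this
      exact (σ g).injective (this.trans hg.symm)
  choose s hs hs' using key
  have : a ∈ t.biUnion s := by
    apply hX
    refine Set.Finite.subset (Set.finite_singleton a) ?_
    rintro _ ⟨g, hg, rfl⟩
    refine ht g (fun b hb => hs' b g fun x hx => hg x ?_)
    exact Finset.mem_biUnion.2 ⟨b, hb, hx⟩
  obtain ⟨b, _, hb⟩ := Finset.mem_biUnion.1 this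
  exact hs b hb

theorem R_smul (ρ : K →* Equiv.Perm X) (σ : K →* Equiv.Perm Y) {a : X} {b : Y}
    (h : R ρ σ a b) (k : K) : R ρ σ (ρ k a) (σ k b) := by
  refine Set.Finite.subset (h.image (ρ k)) ?_
  rintro _ ⟨g, hg, rfl⟩
  refine ⟨ρ (k⁻¹ * g * k) a, ⟨_, ?_, rfl⟩, ?_⟩
  · simp [map_mul, Equiv.Perm.mul_apply, hg]
  · simp [map_mul, Equiv.Perm.mul_apply]

theorem groupIso (ρ : K →* Equiv.Perm X) (σ : K →* Equiv.Perm Y) (hX : NA ρ) (hY : NA σ)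
    (h1 : Supp ρ σ) (h2 : Supp σ ρ) : ∃ θ : X ≃ Y, ∀ g x, θ (ρ g x) = σ g (θ x) := by
  choose f hf using step2 ρ σ hX h1 h2
  choose f' hf' using step2 σ ρ hY h2 h1
  have e1 : ∀ b, f (f' b) = b := fun b => (step1 ρ σ hY (hf (f' b)) (hf' b)).symm
  have e2 : ∀ a, f' (f a) = a := fun a => (step1 σ ρ hX (hf' (f a)) (hf a)).symm
  refine ⟨⟨f, f', e2, e1⟩, fun g x => ?_⟩
  have h := hf' (f (ρ g x))
  rw [e2] at h
  exact step1 ρ σ hY (R_smul ρ σ (hf x) g) h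

end grp

theorem isOpen_fn {Ω : Type*} {s : Set (Ω → Ω)} (hs : @IsOpen _ (FnTop Ω Ω) s) {e : Ω → Ω}
    (he : e ∈ s) : ∃ u : Finset Ω, ∀ f : Ω → Ω, (∀ x ∈ u, f x = e x) → f ∈ s := by
  letI : TopologicalSpace Ω := ⊥
  have hs' : IsOpen s := hs
  obtain ⟨I, u, hu, hsub⟩ := isOpen_pi_iff.1 hs' e he
  refine ⟨I, fun f hf => hsub ?_⟩
  intro i hi
  rw [hf i hi]
  exact (hu i hi).2

theorem isOpen_agree {Ω : Type*} (u : Finset Ω) (e : Ω → Ω) :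
    @IsOpen _ (FnTop Ω Ω) {f : Ω → Ω | ∀ x ∈ u, f x = e x} := by
  letI : TopologicalSpace Ω := ⊥
  haveI : DiscreteTopology Ω := ⟨rfl⟩
  show IsOpen {f : Ω → Ω | ∀ x ∈ u, f x = e x}
  have : {f : Ω → Ω | ∀ x ∈ u, f x = e x} = Set.pi (u : Set Ω) (fun x => {e x}) := by
    ext f; simp [Set.mem_pi]
  rw [this]
  exact isOpen_set_pi u.finite_toSet (fun i _ => isOpen_discrete _)

theorem mem_closure_fn {Ω : Type*} {s : Set (Ω → Ω)} {e : Ω → Ω} :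
    e ∈ @closure _ (FnTop Ω Ω) s ↔ ∀ u : Finset Ω, ∃ f ∈ s, ∀ x ∈ u, f x = e x := by
  rw [@mem_closure_iff _ (FnTop Ω Ω)]
  constructor
  · intro h u
    obtain ⟨f, hf, hfs⟩ := h _ (isOpen_agree u e) (fun _ _ => rfl)
    exact ⟨f, hfs, hf⟩
  · intro h o ho he
    obtain ⟨u, hu⟩ := isOpen_fn ho he
    obtain ⟨f, hfs, hf⟩ := h u
    exact ⟨f, hu f hf, hfs⟩

theorem cont_fin {Ω Ω' : Type*} {M : Submonoid (Function.End Ω)} {N : Submonoid (Function.End Ω')}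
    (φ : M → N) (h : @Continuous M N (subTopM M) (subTopM N) φ) (e : M) (b : Ω') :
    ∃ u : Finset Ω, ∀ f : M, (∀ x ∈ u, f.1 x = e.1 x) → (φ f).1 b = (φ e).1 b := by
  have ho : @IsOpen _ (subTopM N) {n : N | n.1 b = (φ e).1 b} := by
    refine ⟨_, isOpen_agree {b} (φ e).1, ?_⟩
    ext n; simp; rfl
  obtain ⟨s, hs, hse⟩ := @IsOpen.preimage _ _ (subTopM M) (subTopM N) _ h _ ho
  have he : e.1 ∈ s := by
    have : e ∈ Subtype.val ⁻¹' s := by rw [hse]; rfl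
    exact this
  obtain ⟨u, hu⟩ := isOpen_fn hs he
  refine ⟨u, fun f hf => ?_⟩
  have : f ∈ Subtype.val ⁻¹' s := hu _ hf
  rw [hse] at this
  exact this

/-- The unit group acting by permutations. -/
def act {Ω : Type*} (M : Submonoid (Function.End Ω)) : Mˣ →* Equiv.Perm Ω where
  toFun g := ⟨g.1.1, (g⁻¹).1.1, fun x => by
      have : (g⁻¹ * g).1.1 x = x := by rw [inv_mul_cancel]; rfl
      exact this, fun x => by
      have : (g * g⁻¹).1.1 x = x := by rw [mul_inv_cancel]; rfl
      exact this⟩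
  map_one' := rfl
  map_mul' _ _ := rfl

theorem act_apply {Ω : Type*} (M : Submonoid (Function.End Ω)) (g : Mˣ) (x : Ω) :
    act M g x = g.1.1 x := rfl

theorem na_act {Ω : Type*} (M : Submonoid (Function.End Ω)) (h : NoAlg (unitSet M)) :
    NA (act M) := by
  intro s a hfin
  let y : Fin s.card → Ω := fun i => (s.equivFin.symm i).1
  have := h s.card y a (by
    refine hfin.subset ?_
    rintro _ ⟨g, hg, hy, rfl⟩
    let g' : Mˣ := ⟨⟨⇑g, hg.1⟩, ⟨⇑g.symm, hg.2⟩, by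
      apply Subtype.ext; funext x; exact g.apply_symm_apply x, by
      apply Subtype.ext; funext x; exact g.symm_apply_apply x⟩
    refine ⟨g', fun x hx => ?_, rfl⟩
    have := hy (s.equivFin ⟨x, hx⟩)
    simp only [y, Equiv.symm_apply_apply] at this
    exact this)
  obtain ⟨i, rfl⟩ := this
  exact (s.equivFin.symm i).2

theorem na_comp {K L X : Type*} [Group K] [Group L] (ρ : L →* Equiv.Perm X) (f : K ≃* L)
    (h : NA ρ) : NA (ρ.comp f.toMonoidHom) := by
  intro s a hfin
  refine h s a (hfin.subset ?_)
  rintro _ ⟨g, hg, rfl⟩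
  exact ⟨f.symm g, by simpa using hg, by simp⟩

/-- Limits of units avoiding a finite set. -/
theorem exists_h {Ω : Type*} [Countable Ω] (M : Submonoid (Function.End Ω))
    (hM : @IsClosed (Function.End Ω) (endTop Ω) (M : Set (Function.End Ω)))
    (hna : NA (act M)) (a : Ω) (F : Finset Ω) (ha : a ∉ F) :
    ∃ h : M, h.1 a = a ∧ (∀ x, h.1 x ∉ F) ∧
      ∀ u : Finset Ω, ∃ g : Mˣ, ∀ x ∈ u, g.1.1 x = h.1 x := by
  classical
  haveI : Nonempty Ω := ⟨a⟩
  obtain ⟨w, hw⟩ := exists_surjective_nat Ω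
  let P := {p : Finset Ω × Mˣ // ∀ y ∈ p.1, act M p.2 y ∉ F}
  have step : ∀ (p : P) (x : Ω), ∃ q : P, p.1.1 ⊆ q.1.1 ∧ x ∈ q.1.1 ∧
      ∀ y ∈ p.1.1, act M q.1.2 y = act M p.1.2 y := by
    rintro ⟨⟨S, g⟩, hp⟩ x
    by_cases hx : x ∈ S
    · exact ⟨⟨⟨S, g⟩, hp⟩, subset_rfl, hx, fun _ _ => rfl⟩
    have hn : act M g x ∉ S.image (act M g) := by
      simpa using hx
    have : ¬ {b | ∃ k : Mˣ, (∀ y ∈ S.image (act M g), act M k y = y) ∧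
        b = act M k (act M g x)} ⊆ (F : Set Ω) :=
      fun hsub => hn (hna _ _ (F.finite_toSet.subset hsub))
    rw [Set.not_subset] at this
    obtain ⟨_, ⟨k, hk, rfl⟩, hkF⟩ := this
    have hag : ∀ y ∈ S, act M (k * g) y = act M g y := by
      intro y hy
      rw [map_mul, Equiv.Perm.mul_apply]
      exact hk _ (Finset.mem_image_of_mem _ hy)
    refine ⟨⟨⟨insert x S, k * g⟩, ?_⟩, Finset.subset_insert _ _, Finset.mem_insert_self _ _, hag⟩
    intro y hy
    rcases Finset.mem_insert.1 hy with rfl | hy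
    · rw [map_mul, Equiv.Perm.mul_apply]
      exact hkF
    · show act M (k * g) y ∉ F
      rw [hag y hy]; exact hp y hy
  choose nxt n1 n2 n3 using step
  let p0 : P := ⟨⟨{a}, 1⟩, by
    intro y hy
    have : y = a := by simpa using hy
    subst this
    simpa using ha⟩
  let p : ℕ → P := fun n => Nat.rec p0 (fun n q => nxt q (w n)) n
  have psucc : ∀ n, p (n+1) = nxt (p n) (w n) := fun n => rfl
  have mono : ∀ m n, m ≤ n → (p m).1.1 ⊆ (p n).1.1 ∧
      ∀ y ∈ (p m).1.1, act M (p n).1.2 y = act M (p m).1.2 y := by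
    intro m n hmn
    induction n, hmn using Nat.le_induction with
    | base => exact ⟨subset_rfl, fun _ _ => rfl⟩
    | succ n hmn ih =>
      rw [psucc]
      exact ⟨ih.1.trans (n1 _ _), fun y hy => (n3 _ _ y (ih.1 hy)).trans (ih.2 y hy)⟩
  have cov : ∀ y, ∃ n, y ∈ (p n).1.1 := by
    intro y
    obtain ⟨n, rfl⟩ := hw y
    exact ⟨n+1, n2 _ _⟩
  choose ν hν using cov
  let h : Ω → Ω := fun y => act M (p (ν y)).1.2 y
  have hagree : ∀ n, ∀ y ∈ (p n).1.1, act M (p n).1.2 y = h y := by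
    intro n y hy
    rcases le_total n (ν y) with hl | hl
    · exact ((mono _ _ hl).2 y hy).symm
    · exact (mono _ _ hl).2 y (hν y)
  have lim : ∀ u : Finset Ω, ∃ g : Mˣ, ∀ x ∈ u, g.1.1 x = h x := by
    intro u
    refine ⟨(p (u.sup ν)).1.2, fun x hx => ?_⟩
    exact hagree _ x ((mono _ _ (Finset.le_sup (f := ν) hx)).1 (hν x))
  have hmem : (h : Function.End Ω) ∈ M := by
    have : (h : Function.End Ω) ∈ @closure _ (endTop Ω) (M : Set (Function.End Ω)) := by
      refine mem_closure_fn.2 fun u => ?_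
      obtain ⟨g, hg⟩ := lim u
      exact ⟨g.1.1, g.1.2, hg⟩
    rw [@IsClosed.closure_eq _ (endTop Ω) _ hM] at this
    exact this
  refine ⟨⟨h, hmem⟩, ?_, fun x => (p (ν x)).2 x (hν x), lim⟩
  have := hagree 0 a (by simp [p, p0])
  exact this.symm

end TopMonIso

open TopMonIso
theorem topological_monoid_iso_is_action_iso
    {Ω Ω' : Type} [Countable Ω] [Infinite Ω] [Countable Ω'] [Infinite Ω']
    (M : Submonoid (Function.End Ω)) (N : Submonoid (Function.End Ω'))
    (hMclosed : @IsClosed (Function.End Ω) (endTop Ω) (M : Set (Function.End Ω)))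
    (hNclosed : @IsClosed (Function.End Ω') (endTop Ω') (N : Set (Function.End Ω')))
    (hMoligo : Oligo (unitSet M)) (hMnoalg : NoAlg (unitSet M))
    (hNoligo : Oligo (unitSet N)) (hNnoalg : NoAlg (unitSet N))
    (hftodense : (M : Set (Function.End Ω)) ⊆
      @closure (Function.End Ω) (endTop Ω) {e | e ∈ M ∧ FinToOne e})
    (φ : M ≃* N)
    (hφcont : @Continuous M N (subTopM M) (subTopM N) ⇑φ)
    (hφsymmcont : @Continuous N M (subTopM N) (subTopM M) ⇑φ.symm) :
    ∃ θ : Ω ≃ Ω', ∀ (e : M) (x : Ω'),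
      (↑(φ e) : Function.End Ω') x = θ ((↑e : Function.End Ω) (θ.symm x)) := by
  classical
  have naM := na_act M hMnoalg
  have naN := na_act N hNnoalg
  let ψ : Mˣ ≃* Nˣ := Units.mapEquiv φ
  let σ : Mˣ →* Equiv.Perm Ω' := (act N).comp ψ.toMonoidHom
  have hσ : ∀ g x, σ g x = (φ g.1).1 x := fun g x => rfl
  have h1 : Supp (act M) σ := by
    intro b
    obtain ⟨u, hu⟩ := cont_fin φ hφcont 1 b
    refine ⟨u, fun g hg => ?_⟩
    have := hu g.1 (fun x hx => hg x hx)
    rw [map_one] at this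
    exact this
  have h2 : Supp σ (act M) := by
    intro b
    obtain ⟨u, hu⟩ := cont_fin φ.symm hφsymmcont 1 b
    refine ⟨u, fun g hg => ?_⟩
    have := hu (φ g.1) (fun x hx => hg x hx)
    rw [map_one, MulEquiv.symm_apply_apply] at this
    exact this
  obtain ⟨θ, hθ⟩ := groupIso (act M) σ naM (na_comp _ ψ naN) h1 h2
  have hlim : ∀ h : M, (∀ u : Finset Ω, ∃ g : Mˣ, ∀ x ∈ u, g.1.1 x = h.1 x) →
      ∀ a, (φ h).1 (θ a) = θ (h.1 a) := by
    intro h hh a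
    obtain ⟨u, hu⟩ := cont_fin φ hφcont h (θ a)
    obtain ⟨g, hg⟩ := hh (insert a u)
    rw [← hu g.1 (fun x hx => hg x (Finset.mem_insert_of_mem hx)),
      ← hg a (Finset.mem_insert_self _ _)]
    exact (hθ g a).symm
  have hmul : ∀ (e f : M) (x : Ω'), (φ (e * f)).1 x = (φ e).1 ((φ f).1 x) := by
    intro e f x
    rw [map_mul]; rfl
  have hfto : ∀ e : M, FinToOne e.1 → ∀ a, (φ e).1 (θ a) = θ (e.1 a) := by
    intro e he a
    obtain ⟨d, hd⟩ := θ.surjective ((φ e).1 (θ a))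
    let F : Finset Ω := (he d).toFinset.erase a
    obtain ⟨h, ha, hF, hl⟩ := exists_h M hMclosed naM a F (by simp [F])
    obtain ⟨v, hv⟩ := cont_fin φ hφcont (e * h) (θ a)
    have hval : (φ (e * h)).1 (θ a) = θ d := by
      rw [hmul, hlim h hl, ha, hd]
    have hdm : d ∈ v.image (e * h).1 := by
      apply naM
      refine (Set.finite_singleton d).subset ?_
      rintro _ ⟨g, hg, rfl⟩
      have := hv (g.1 * (e * h)) (fun x hx => hg _ (Finset.mem_image_of_mem _ hx))
      rw [hmul, hval] at this
      have h3 := hθ g d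
      rw [hσ, this] at h3
      exact θ.injective h3
    obtain ⟨x, _, hx⟩ := Finset.mem_image.1 hdm
    have hx' : e.1 (h.1 x) = d := hx
    have hxa : h.1 x = a := by
      by_contra hne
      apply hF x
      simp [F, hne, hx']
    rw [← hd, ← hx', hxa]
  have hall : ∀ (e : M) a, (φ e).1 (θ a) = θ (e.1 a) := by
    intro e a
    obtain ⟨v, hv⟩ := cont_fin φ hφcont e (θ a)
    obtain ⟨f, ⟨hfM, hf⟩, hfe⟩ := mem_closure_fn.1 (hftodense e.2) (insert a v)
    have h4 := hv ⟨f, hfM⟩ (fun x hx => hfe x (Finset.mem_insert_of_mem hx))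
    rw [← h4, hfto ⟨f, hfM⟩ hf a]
    exact congrArg θ (hfe a (Finset.mem_insert_self _ _))
  refine ⟨θ, fun e x => ?_⟩
  have := hall e (θ.symm x)
  rw [θ.apply_symm_apply] at this
  exact this
end

section
/- Fix a countable relational language L with relation symbols R_i of arity a_i (i ∈ ℕ), and let X := ∏_{i∈ℕ} Bool^{(Fin a_i → ℕ)} be the Polish space of L-structures with domain ℕ (product topology, Bool discrete), equipped with its Borel σ-algebra. Then there exists a Borel-measurable function f: X → ℝ such that for all x, y ∈ X that are ω-categorical model-complete cores without algebraicity: End(x) and End(y) are isomorphic as topological monoids (equivalently, x and y are ep-bi-interpretable) if and only if f(x) = f(y). In other words, ep-bi-interpretability is smooth on the class of ω-categorical model-complete cores without algebraicity. -/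
/-- Codes for structures on `ℕ` in the countable relational language whose `i`-th
relation symbol has arity `a i`. -/
abbrev Codes (a : ℕ → ℕ) := ∀ i : ℕ, (Fin (a i) → ℕ) → Bool

/-- The product topology on the space of codes (`Bool` discrete), turning it into
a Polish space. -/
def XTop (a : ℕ → ℕ) : TopologicalSpace (Codes a) :=
  @Pi.topologicalSpace _ _ (fun _ => @Pi.topologicalSpace _ _ (fun _ => ⊥))

/-- The automorphisms of the structure coded by `x`: permutations of `ℕ`
preserving each relation and its complement. -/
def AutX {a : ℕ → ℕ} (x : Codes a) : Set (Equiv.Perm ℕ) :=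
  {g | ∀ (i : ℕ) (t : Fin (a i) → ℕ), x i (fun j => g (t j)) = x i t}

/-- The structure coded by `x` is ω-categorical. -/
def OmegaCatX {a : ℕ → ℕ} (x : Codes a) : Prop := Oligo (AutX x)

/-- The endomorphism monoid of the structure coded by `x`, as a submonoid of
`Function.End ℕ`. -/
def EndX {a : ℕ → ℕ} (x : Codes a) : Submonoid (Function.End ℕ) where
  carrier := {e | ∀ (i : ℕ) (t : Fin (a i) → ℕ), x i t = true → x i (fun j => e (t j)) = true}
  one_mem' := by intro i t h; exact h
  mul_mem' := by
    intro e f he hf i t h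
    exact he i (fun j => f (t j)) (hf i t h)

/-- The topology of pointwise convergence on the endomorphism monoid. -/
def endXTop {a : ℕ → ℕ} (x : Codes a) : TopologicalSpace (EndX x) :=
  TopologicalSpace.induced Subtype.val (endTop ℕ)

/-- The endomorphism monoids of `x` and `y` are topologically isomorphic;
for ω-categorical model-complete cores without algebraicity this is equivalent
to ep-bi-interpretability. -/
def EpBiInt {a : ℕ → ℕ} (x y : Codes a) : Prop :=
  ∃ φ : EndX x ≃* EndX y,
    @Continuous _ _ (endXTop x) (endXTop y) ⇑φ ∧
    @Continuous _ _ (endXTop y) (endXTop x) ⇑φ.symm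

/-- The structure coded by `x` is a model-complete core: every endomorphism
agrees on every finite set with some automorphism. -/
def MCCoreX {a : ℕ → ℕ} (x : Codes a) : Prop :=
  ∀ e ∈ EndX x, ∀ S : Finset ℕ, ∃ g ∈ AutX x, ∀ s ∈ S, g s = e s

/-- The structure coded by `x` is without algebraicity. -/
def NoAlgX {a : ℕ → ℕ} (x : Codes a) : Prop := NoAlg (AutX x)

section Reconstruction

variable {G Ω : Type*} [Group G]

/-- `a` has finite orbit (via `ρ₁`) under the stabiliser of `c` (via `ρ₂`). -/
def AlgPt (ρ₁ ρ₂ : G →* Equiv.Perm Ω) (a c : Ω) : Prop :=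
  Set.Finite {b : Ω | ∃ g, ρ₂ g c = c ∧ b = ρ₁ g a}

/-- no algebraicity for a permutation representation -/
def NoAlgRep (ρ : G →* Equiv.Perm Ω) : Prop :=
  ∀ (S : Finset Ω) (a : Ω), Set.Finite {b : Ω | ∃ g, (∀ s ∈ S, ρ g s = s) ∧ b = ρ g a} → a ∈ S

/-- point stabilisers for `ρ₁` are open for `ρ₂`. -/
def OpenRep (ρ₁ ρ₂ : G →* Equiv.Perm Ω) : Prop :=
  ∀ a, ∃ S : Finset Ω, ∀ g, (∀ s ∈ S, ρ₂ g s = s) → ρ₁ g a = a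

theorem algPt_exists (ρ₁ ρ₂ : G →* Equiv.Perm Ω) (h1 : NoAlgRep ρ₁)
    (h12 : OpenRep ρ₁ ρ₂) (h21 : OpenRep ρ₂ ρ₁) (a : Ω) : ∃ c, AlgPt ρ₁ ρ₂ a c := by
  classical
  by_contra hcon
  push Not at hcon
  obtain ⟨S, hS⟩ := h12 a
  choose U hU using h21
  have hex : ∀ c, ∃ g, ρ₂ g c = c ∧ ρ₁ g a ∉ U c := by
    intro c
    by_contra hc
    push Not at hc
    apply hcon c
    apply (U c).finite_toSet.subset
    rintro b ⟨g, hg, rfl⟩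
    exact hc g hg
  choose γ hγ1 hγ2 using hex
  have := h1 (S.biUnion fun c => (U c).image (ρ₁ (γ c)⁻¹)) a (by
    apply (Set.finite_singleton a).subset
    rintro b ⟨g, hg, rfl⟩
    apply hS
    intro c hc
    have h := hU c (γ c * g * (γ c)⁻¹) (by
      intro s hs
      have := hg (ρ₁ (γ c)⁻¹ s) (Finset.mem_biUnion.2 ⟨c, hc, Finset.mem_image_of_mem _ hs⟩)
      simp only [map_mul, Equiv.Perm.mul_apply, this]
      simp)
    have hi : ρ₂ (γ c)⁻¹ c = c := by
      rw [map_inv, Equiv.Perm.inv_eq_iff_eq]; exact (hγ1 c).symm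
    simp only [map_mul, Equiv.Perm.mul_apply, hi] at h
    have h' : ρ₂ (γ c) (ρ₂ g c) = ρ₂ (γ c) c := h.trans (hγ1 c).symm
    exact (ρ₂ (γ c)).injective h')
  obtain ⟨c, hc, hc'⟩ := Finset.mem_biUnion.1 this
  obtain ⟨u, hu, rfl⟩ := Finset.mem_image.1 hc'
  apply hγ2 c
  simpa using hu

theorem algPt_trans (ρ₁ ρ₂ : G →* Equiv.Perm Ω) (h1 : NoAlgRep ρ₁) {a c a' : Ω}
    (h : AlgPt ρ₁ ρ₂ a c) (h' : AlgPt ρ₂ ρ₁ c a') : a = a' := by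
  classical
  have := h1 {a'} a (by
    have hch : ∀ c' ∈ {b : Ω | ∃ g, ρ₁ g a' = a' ∧ b = ρ₂ g c}, ∃ g, c' = ρ₂ g c := by
      rintro c' ⟨g, _, hg⟩; exact ⟨g, hg⟩
    choose! γ hγ using hch
    apply (h'.biUnion (fun c' _ => h.image (ρ₁ (γ c')))).subset
    rintro b ⟨g, hg, rfl⟩
    have hm : ρ₂ g c ∈ {b : Ω | ∃ g, ρ₁ g a' = a' ∧ b = ρ₂ g c} :=
      ⟨g, hg a' (by simp), rfl⟩
    refine Set.mem_biUnion hm ⟨ρ₁ ((γ (ρ₂ g c))⁻¹ * g) a, ⟨_, ?_, rfl⟩, ?_⟩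
    · rw [map_mul, map_inv, Equiv.Perm.mul_apply, Equiv.Perm.inv_eq_iff_eq]
      exact hγ _ hm
    · simp)
  simpa using this

theorem algPt_smul (ρ₁ ρ₂ : G →* Equiv.Perm Ω) {a c : Ω} (h : AlgPt ρ₁ ρ₂ a c) (k : G) :
    AlgPt ρ₁ ρ₂ (ρ₁ k a) (ρ₂ k c) := by
  apply (h.image (ρ₁ k)).subset
  rintro b ⟨g, hg, rfl⟩
  refine ⟨ρ₁ (k⁻¹ * g * k) a, ⟨_, ?_, rfl⟩, ?_⟩
  · simp only [map_mul, Equiv.Perm.mul_apply, hg]; simp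
  · simp

theorem reconstruct (ρ₁ ρ₂ : G →* Equiv.Perm Ω) (h1 : NoAlgRep ρ₁) (h2 : NoAlgRep ρ₂)
    (h12 : OpenRep ρ₁ ρ₂) (h21 : OpenRep ρ₂ ρ₁) :
    ∃ σ : Equiv.Perm Ω, ∀ g a, ρ₂ g (σ a) = σ (ρ₁ g a) := by
  choose F hF using algPt_exists ρ₁ ρ₂ h1 h12 h21
  choose H hH using algPt_exists ρ₂ ρ₁ h2 h21 h12
  have e1 : ∀ a, H (F a) = a := fun a => (algPt_trans ρ₁ ρ₂ h1 (hF a) (hH _)).symm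
  have e2 : ∀ a, F (H a) = a := fun a => (algPt_trans ρ₂ ρ₁ h2 (hH a) (hF _)).symm
  refine ⟨⟨F, H, e1, e2⟩, fun g a => ?_⟩
  have := algPt_trans ρ₁ ρ₂ h1 (algPt_smul ρ₁ ρ₂ (hF a) g) (hH _)
  change ρ₂ g (F a) = F (ρ₁ g a)
  rw [this, e2]

end Reconstruction

theorem endX_open {a : ℕ → ℕ} {x y : Codes a} (h : EndX x → EndX y) (h1 : h 1 = 1)
    (hc : @Continuous _ _ (endXTop x) (endXTop y) h) (c : ℕ) :
    ∃ S : Finset ℕ, ∀ e : EndX x, (∀ s ∈ S, e.1 s = s) → (h e).1 c = c := by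
  let t1 := endXTop x
  let t2 := endXTop y
  let : TopologicalSpace ℕ := ⊥
  have ho : IsOpen {e : EndX y | e.1 c = c} := by
    refine ⟨{f : ℕ → ℕ | f c = c}, ?_, rfl⟩
    exact (isOpen_discrete ({c} : Set ℕ)).preimage (continuous_apply (A := fun _ : ℕ => ℕ) c)
  obtain ⟨V, hV, hVe⟩ := ho.preimage hc
  have hV' := (@isOpen_pi_iff ℕ (fun _ => ℕ) (fun _ => ⊥) V).1 hV
  have hid : (id : ℕ → ℕ) ∈ V := by
    have : (1 : EndX x) ∈ h ⁻¹' {e : EndX y | e.1 c = c} := by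
      change (h 1).1 c = c
      rw [h1]; rfl
    rw [← hVe] at this
    exact this
  obtain ⟨S, u, hu, hsub⟩ := hV' _ hid
  refine ⟨S, fun e he => ?_⟩
  have : e ∈ h ⁻¹' {e : EndX y | e.1 c = c} := by
    rw [← hVe]
    apply hsub
    intro s hs
    rw [he s hs]
    exact (hu s hs).2
  exact this

/-- the permutation representation of the unit group. -/
def unitRep {a : ℕ → ℕ} (x : Codes a) : (EndX x)ˣ →* Equiv.Perm ℕ :=
  Equiv.Perm.equivUnitsEnd.symm.toMonoidHom.comp (Units.map (EndX x).subtype)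

theorem unitRep_apply {a : ℕ → ℕ} (x : Codes a) (g : (EndX x)ˣ) (n : ℕ) :
    unitRep x g n = g.1.1 n := rfl

theorem mem_autX_iff {a : ℕ → ℕ} (x : Codes a) (g : Equiv.Perm ℕ) :
    g ∈ AutX x ↔ ∃ u, unitRep x u = g := by
  constructor
  · intro hg
    refine ⟨⟨⟨⇑g, ?_⟩, ⟨⇑g.symm, ?_⟩, ?_, ?_⟩, ?_⟩
    · intro i t h
      rw [hg i t, h]
    · intro i t h
      rw [← hg i, ← h]; simp
    · apply Subtype.ext; funext n; exact g.apply_symm_apply n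
    · apply Subtype.ext; funext n; exact g.symm_apply_apply n
    · ext n; rfl
  · rintro ⟨u, rfl⟩ i t
    have h1 := u.1.2 i t
    have h2 := u⁻¹.1.2 i (fun j => unitRep x u (t j))
    have h3 : (fun j => ((u⁻¹ : (EndX x)ˣ) : EndX x).1 (unitRep x u (t j))) = t := by
      funext j
      change (unitRep x u⁻¹) (unitRep x u (t j)) = t j
      simp
    rw [h3] at h2
    rw [Bool.eq_iff_iff]
    exact ⟨h2, h1⟩

theorem noAlgRep_of {a : ℕ → ℕ} (x : Codes a) (hx : NoAlgX x) : NoAlgRep (unitRep x) := by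
  intro S b hb
  obtain ⟨i, hi⟩ := hx S.card (fun i => (S.equivFin.symm i : ℕ)) b (by
    apply hb.subset
    rintro c ⟨g, hg, hgS, rfl⟩
    obtain ⟨u, rfl⟩ := (mem_autX_iff x g).1 hg
    refine ⟨u, fun s hs => ?_, rfl⟩
    have := hgS (S.equivFin ⟨s, hs⟩)
    simpa using this)
  rw [hi]; exact (S.equivFin.symm i).2

theorem conj_of_epBiInt {a : ℕ → ℕ} {x y : Codes a} (hx : NoAlgX x) (hy : NoAlgX y)
    (h : EpBiInt x y) : ∃ σ : Equiv.Perm ℕ, ∀ g, g ∈ AutX x ↔ σ * g * σ⁻¹ ∈ AutX y := by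
  obtain ⟨φ, h1, h2⟩ := h
  set Φ := Units.mapEquiv φ
  obtain ⟨σ, hσ⟩ := reconstruct (unitRep x) ((unitRep y).comp Φ.toMonoidHom)
    (noAlgRep_of x hx) (by
      intro S b hb
      apply noAlgRep_of y hy S b
      apply hb.subset
      rintro c ⟨g, hg, rfl⟩
      exact ⟨Φ.symm g, by simpa using hg, by simp⟩)
    (by
      intro c
      obtain ⟨S, hS⟩ := endX_open φ.symm (map_one _) h2 c
      refine ⟨S, fun g hg => ?_⟩
      have := hS (Φ g) (fun s hs => hg s hs)
      have e : φ.symm ((Φ g : (EndX y)ˣ) : EndX y) = g.1 := φ.symm_apply_apply g.1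
      rw [e] at this
      exact this)
    (by
      intro c
      obtain ⟨S, hS⟩ := endX_open φ (map_one _) h1 c
      exact ⟨S, fun g hg => hS g (fun s hs => hg s hs)⟩)
  have key : ∀ u, σ * unitRep x u * σ⁻¹ = unitRep y (Φ u) := by
    intro u
    ext n
    have := hσ u (σ⁻¹ n)
    simp only [Equiv.Perm.mul_apply]
    rw [← this]; simp
  refine ⟨σ, fun g => ?_⟩
  rw [mem_autX_iff, mem_autX_iff]
  constructor
  · rintro ⟨u, rfl⟩
    exact ⟨Φ u, (key u).symm⟩
  · rintro ⟨u, hu⟩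
    refine ⟨Φ.symm u, ?_⟩
    have := key (Φ.symm u)
    rw [MulEquiv.apply_symm_apply, hu] at this
    simpa using this

section BackForth

theorem bf_general {St : Type} (gr : St → Set (ℕ × ℕ))
    (heq : ∀ s, ∀ p ∈ gr s, ∀ q ∈ gr s, p.1 = q.1 ↔ p.2 = q.2)
    (forth : ∀ s a, ∃ s' b, gr s ⊆ gr s' ∧ (a, b) ∈ gr s')
    (back : ∀ s b, ∃ s' a, gr s ⊆ gr s' ∧ (a, b) ∈ gr s') (s₀ : St) :
    ∃ σ : Equiv.Perm ℕ, (∀ p ∈ gr s₀, σ p.1 = p.2) ∧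
      ∀ S : Finset ℕ, ∃ s, ∀ a ∈ S, (a, σ a) ∈ gr s := by
  classical
  let : Preorder St := Preorder.lift gr
  let D : ℕ ⊕ ℕ → Order.Cofinal St := fun i =>
    match i with
    | Sum.inl a => ⟨{s | ∃ b, (a, b) ∈ gr s}, fun s => by
        obtain ⟨s', b, h1, h2⟩ := forth s a
        exact ⟨s', ⟨b, h2⟩, h1⟩⟩
    | Sum.inr b => ⟨{s | ∃ a, (a, b) ∈ gr s}, fun s => by
        obtain ⟨s', a, h1, h2⟩ := back s b
        exact ⟨s', ⟨a, h2⟩, h1⟩⟩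
  let I := Order.idealOfCofinals s₀ D
  have hdir : ∀ s ∈ I, ∀ t ∈ I, ∃ r ∈ I, gr s ⊆ gr r ∧ gr t ⊆ gr r := fun s hs t ht => by
    obtain ⟨r, hr, h1, h2⟩ := I.directed s hs t ht
    exact ⟨r, hr, h1, h2⟩
  have h0 : s₀ ∈ I := Order.mem_idealOfCofinals _ _
  have hf : ∀ a, ∃ b, ∃ s ∈ I, (a, b) ∈ gr s := fun a => by
    obtain ⟨s, ⟨b, hb⟩, hs⟩ := Order.cofinal_meets_idealOfCofinals s₀ D (Sum.inl a)
    exact ⟨b, s, hs, hb⟩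
  have hb : ∀ b, ∃ a, ∃ s ∈ I, (a, b) ∈ gr s := fun b => by
    obtain ⟨s, ⟨a, ha⟩, hs⟩ := Order.cofinal_meets_idealOfCofinals s₀ D (Sum.inr b)
    exact ⟨a, s, hs, ha⟩
  have hcomp : ∀ p q : ℕ × ℕ, (∃ s ∈ I, p ∈ gr s) → (∃ s ∈ I, q ∈ gr s) →
      (p.1 = q.1 ↔ p.2 = q.2) := by
    rintro p q ⟨s, hs, hp⟩ ⟨t, ht, hq⟩
    obtain ⟨r, hr, h1, h2⟩ := hdir s hs t ht
    exact heq r p (h1 hp) q (h2 hq)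
  choose F hF using hf
  choose H hH using hb
  let σ : Equiv.Perm ℕ := ⟨F, H, fun a => ((hcomp (a, F a) (H (F a), F a) (hF _) (hH _)).2 rfl).symm,
    fun b => ((hcomp (H b, b) (H b, F (H b)) (hH _) (hF _)).1 rfl).symm⟩
  refine ⟨σ, fun p hp => (hcomp (p.1, F p.1) p (hF _) ⟨s₀, h0, hp⟩).1 rfl, fun S => ?_⟩
  suffices ∃ s ∈ I, ∀ a ∈ S, (a, σ a) ∈ gr s by
    obtain ⟨s, _, h⟩ := this; exact ⟨s, h⟩
  induction S using Finset.induction_on with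
  | empty => exact ⟨s₀, h0, by simp⟩
  | insert a S _ ih =>
    obtain ⟨s, hs, h⟩ := ih
    obtain ⟨t, ht, h'⟩ := hF a
    obtain ⟨r, hr, h1, h2⟩ := hdir s hs t ht
    refine ⟨r, hr, fun b hb => ?_⟩
    rcases Finset.mem_insert.1 hb with rfl | hb
    · exact h2 h'
    · exact h1 (h b hb)

theorem bf_tuples (R : ∀ k, (Fin k → ℕ) → (Fin k → ℕ) → Prop)
    (heq : ∀ k u v, R k u v → ∀ i j, u i = u j ↔ v i = v j)
    (forth : ∀ k u v, R k u v → ∀ a, ∃ b, R (k + 1) (Fin.snoc u a) (Fin.snoc v b))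
    (back : ∀ k u v, R k u v → ∀ b, ∃ a, R (k + 1) (Fin.snoc u a) (Fin.snoc v b))
    {k : ℕ} {u v : Fin k → ℕ} (huv : R k u v) :
    ∃ σ : Equiv.Perm ℕ, (∀ i, σ (u i) = v i) ∧
      ∀ (n : ℕ) (t : Fin n → ℕ), ∃ (k' : ℕ) (u' v' : Fin k' → ℕ), R k' u' v' ∧
        ∃ s : Fin n → Fin k', t = u' ∘ s ∧ σ ∘ t = v' ∘ s := by
  classical
  let St := {p : Σ k, (Fin k → ℕ) × (Fin k → ℕ) // R p.1 p.2.1 p.2.2}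
  let gr : St → Set (ℕ × ℕ) := fun p => Set.range fun i => (p.1.2.1 i, p.1.2.2 i)
  have hsub : ∀ (k) (u v : Fin k → ℕ) (a b : ℕ), (Set.range fun i => (u i, v i)) ⊆
      Set.range fun i => ((Fin.snoc u a : Fin (k+1) → ℕ) i, (Fin.snoc v b : Fin (k+1) → ℕ) i) := by
    rintro k u v a b _ ⟨i, rfl⟩
    exact ⟨i.castSucc, by simp⟩
  have hlast : ∀ (k) (u v : Fin k → ℕ) (a b : ℕ), (a, b) ∈
      Set.range fun i => ((Fin.snoc u a : Fin (k+1) → ℕ) i, (Fin.snoc v b : Fin (k+1) → ℕ) i) :=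
    fun k u v a b => ⟨Fin.last k, by simp⟩
  obtain ⟨σ, h1, h2⟩ := bf_general gr
    (by
      rintro ⟨⟨k, u, v⟩, h⟩ _ ⟨i, rfl⟩ _ ⟨j, rfl⟩
      exact heq k u v h i j)
    (by
      rintro ⟨⟨k, u, v⟩, h⟩ a
      obtain ⟨b, hb⟩ := forth k u v h a
      exact ⟨⟨⟨k + 1, _, _⟩, hb⟩, b, hsub _ _ _ _ _, hlast _ _ _ _ _⟩)
    (by
      rintro ⟨⟨k, u, v⟩, h⟩ b
      obtain ⟨a, hb⟩ := back k u v h b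
      exact ⟨⟨⟨k + 1, _, _⟩, hb⟩, a, hsub _ _ _ _ _, hlast _ _ _ _ _⟩)
    ⟨⟨k, u, v⟩, huv⟩
  refine ⟨σ, fun i => h1 _ ⟨i, rfl⟩, fun n t => ?_⟩
  obtain ⟨⟨⟨k', u', v'⟩, h⟩, hs⟩ := h2 (Finset.univ.image t)
  have : ∀ j, ∃ i, (u' i, v' i) = (t j, σ (t j)) := fun j => hs (t j) (by simp)
  choose s hs' using this
  exact ⟨k', u', v', h, s, funext fun j => (congrArg Prod.fst (hs' j)).symm,
    funext fun j => (congrArg Prod.snd (hs' j)).symm⟩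

end BackForth

section Orbits

variable {a : ℕ → ℕ}

/-- orbit equivalence of tuples -/
def Orb (x : Codes a) {k : ℕ} (u v : Fin k → ℕ) : Prop := ∃ g ∈ AutX x, v = g ∘ u

theorem autX_symm {x : Codes a} {g : Equiv.Perm ℕ} (hg : g ∈ AutX x) : g⁻¹ ∈ AutX x := by
  rw [mem_autX_iff] at *
  obtain ⟨u, rfl⟩ := hg
  exact ⟨u⁻¹, map_inv _ _⟩

theorem autX_mul {x : Codes a} {g h : Equiv.Perm ℕ} (hg : g ∈ AutX x) (hh : h ∈ AutX x) :
    g * h ∈ AutX x := by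
  rw [mem_autX_iff] at *
  obtain ⟨u, rfl⟩ := hg
  obtain ⟨v, rfl⟩ := hh
  exact ⟨u * v, map_mul _ _ _⟩

theorem Orb.refl (x : Codes a) {k : ℕ} (u : Fin k → ℕ) : Orb x u u :=
  ⟨1, fun _ _ => rfl, rfl⟩

theorem Orb.symm {x : Codes a} {k : ℕ} {u v : Fin k → ℕ} (h : Orb x u v) : Orb x v u := by
  obtain ⟨g, hg, rfl⟩ := h
  refine ⟨g⁻¹, autX_symm hg, ?_⟩
  funext i; simp

theorem Orb.trans {x : Codes a} {k : ℕ} {u v w : Fin k → ℕ} (h : Orb x u v) (h' : Orb x v w) :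
    Orb x u w := by
  obtain ⟨g, hg, rfl⟩ := h
  obtain ⟨g', hg', rfl⟩ := h'
  exact ⟨g' * g, autX_mul hg' hg, rfl⟩

theorem Orb.comp {x : Codes a} {k j : ℕ} {u v : Fin k → ℕ} (h : Orb x u v) (s : Fin j → Fin k) :
    Orb x (u ∘ s) (v ∘ s) := by
  obtain ⟨g, hg, rfl⟩ := h
  exact ⟨g, hg, rfl⟩

theorem oligo_bound {x : Codes a} (hx : OmegaCatX x) (k : ℕ) :
    ∃ N : ℕ, ∀ u : Fin k → ℕ, ∀ M, N ≤ M → ∃ p : Fin k → Fin M, Orb x (fun i => (p i : ℕ)) u := by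
  classical
  have hfin := hx k
  set O := {o : Set (Fin k → ℕ) | ∃ t : Fin k → ℕ, o = {s | ∃ g ∈ AutX x, s = tAct g t}}
  have hrep : ∀ o ∈ O, ∃ t : Fin k → ℕ, o = {s | ∃ g ∈ AutX x, s = tAct g t} := fun o ho => ho
  choose! r hr using hrep
  let T := hfin.toFinset
  refine ⟨(T.sup fun o => Finset.univ.sup (r o)) + 1, fun u M hM => ?_⟩
  set o := {s | ∃ g ∈ AutX x, s = tAct g u} with ho
  have hoO : o ∈ O := ⟨u, rfl⟩
  have hlt : ∀ i, r o i < M := by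
    intro i
    have h1 : r o i ≤ Finset.univ.sup (r o) := Finset.le_sup (f := r o) (Finset.mem_univ i)
    have h2 : Finset.univ.sup (r o) ≤ T.sup fun o => Finset.univ.sup (r o) :=
      Finset.le_sup (f := fun o => Finset.univ.sup (r o)) (hfin.mem_toFinset.2 hoO)
    omega
  refine ⟨fun i => ⟨r o i, hlt i⟩, ?_⟩
  have hu : u ∈ o := ⟨1, fun _ _ => rfl, rfl⟩
  rw [hr o hoO] at hu
  exact hu

/-- finite levels of back-and-forth equivalence -/
def BF (x : Codes a) : ℕ → ∀ k, (Fin k → ℕ) → (Fin k → ℕ) → Prop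
  | 0, k, u, v => (∀ i j, u i = u j ↔ v i = v j) ∧
      ∀ i (s : Fin (a i) → Fin k), x i (u ∘ s) = x i (v ∘ s)
  | m + 1, k, u, v => BF x m k u v ∧
      (∀ c, ∃ d, BF x m (k + 1) (Fin.snoc u c) (Fin.snoc v d)) ∧
      (∀ d, ∃ c, BF x m (k + 1) (Fin.snoc u c) (Fin.snoc v d))

/-- elementary-type equivalence of tuples, in back-and-forth form -/
def ET (x : Codes a) {k : ℕ} (u v : Fin k → ℕ) : Prop := ∀ m, BF x m k u v

theorem BF.refl (x : Codes a) (m k : ℕ) (u : Fin k → ℕ) : BF x m k u u := by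
  induction m generalizing k with
  | zero => exact ⟨fun _ _ => Iff.rfl, fun _ _ => rfl⟩
  | succ m ih => exact ⟨ih _ _, fun c => ⟨c, ih _ _⟩, fun c => ⟨c, ih _ _⟩⟩

theorem BF.symm {x : Codes a} {m k : ℕ} {u v : Fin k → ℕ} (h : BF x m k u v) : BF x m k v u := by
  induction m generalizing k with
  | zero => exact ⟨fun i j => (h.1 i j).symm, fun i s => (h.2 i s).symm⟩
  | succ m ih =>
    refine ⟨ih h.1, fun c => ?_, fun c => ?_⟩
    · obtain ⟨d, hd⟩ := h.2.2 c
      exact ⟨d, ih hd⟩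
    · obtain ⟨d, hd⟩ := h.2.1 c
      exact ⟨d, ih hd⟩

theorem BF.mono {x : Codes a} {m m' k : ℕ} {u v : Fin k → ℕ} (hm : m ≤ m') (h : BF x m' k u v) :
    BF x m k u v := by
  induction m', hm using Nat.le_induction with
  | base => exact h
  | succ m' _ ih => exact ih h.1

theorem BF.orb {x : Codes a} {m k : ℕ} {u v w : Fin k → ℕ} (h : BF x m k u v) (h' : Orb x v w) :
    BF x m k u w := by
  obtain ⟨g, hg, rfl⟩ := h'
  induction m generalizing k with
  | zero =>
    refine ⟨fun i j => (h.1 i j).trans (by simp), fun i s => (h.2 i s).trans ?_⟩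
    exact (hg i (v ∘ s)).symm
  | succ m ih =>
    refine ⟨ih h.1, fun c => ?_, fun c => ?_⟩
    · obtain ⟨d, hd⟩ := h.2.1 c
      refine ⟨g d, ?_⟩
      rw [← Fin.comp_snoc]
      exact ih hd
    · obtain ⟨d, hd⟩ := h.2.2 (g⁻¹ c)
      refine ⟨d, ?_⟩
      have := ih hd
      rw [Fin.comp_snoc] at this
      simpa using this

theorem ET.forth {x : Codes a} (hx : OmegaCatX x) {k : ℕ} {u v : Fin k → ℕ} (h : ET x u v) (c : ℕ) :
    ∃ d, ET x (Fin.snoc u c : Fin (k + 1) → ℕ) (Fin.snoc v d) := by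
  obtain ⟨N, hN⟩ := oligo_bound hx (k + 1)
  let U : Ultrafilter ℕ := Filter.hyperfilter ℕ
  have h1 : ∀ m, ∃ p : Fin (k + 1) → Fin N, ∃ d, Orb x (fun i => (p i : ℕ)) (Fin.snoc v d) ∧
      BF x m (k + 1) (Fin.snoc u c) (Fin.snoc v d) := by
    intro m
    obtain ⟨d, hd⟩ := (h (m + 1)).2.1 c
    obtain ⟨p, hp⟩ := hN (Fin.snoc v d) N le_rfl
    exact ⟨p, d, hp, hd⟩
  have h2 : ∀ᶠ m in U, ∃ p : Fin (k + 1) → Fin N, ∃ d,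
      Orb x (fun i => (p i : ℕ)) (Fin.snoc v d) ∧
      BF x m (k + 1) (Fin.snoc u c) (Fin.snoc v d) := Filter.Eventually.of_forall h1
  rw [Ultrafilter.eventually_exists_iff] at h2
  obtain ⟨p, hp⟩ := h2
  obtain ⟨m₀, d₀, hd₀, -⟩ := hp.exists
  refine ⟨d₀, fun m => ?_⟩
  have hge : ∀ᶠ n in U, m ≤ n := by
    have := (Filter.eventually_ge_atTop m)
    rw [← Nat.cofinite_eq_atTop] at this
    exact Filter.hyperfilter_le_cofinite this
  obtain ⟨m', ⟨d, hd, hbf⟩, hm⟩ := (hp.and hge).exists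
  exact (hbf.mono hm).orb (hd.symm.trans hd₀)

theorem ET.symm {x : Codes a} {k : ℕ} {u v : Fin k → ℕ} (h : ET x u v) : ET x v u :=
  fun m => (h m).symm

theorem et_iff_orb {x : Codes a} (hx : OmegaCatX x) {k : ℕ} (u v : Fin k → ℕ) :
    ET x u v ↔ Orb x u v := by
  constructor
  · intro h
    obtain ⟨σ, h1, h2⟩ := bf_tuples (fun k u v => ET x u v) (fun k u v h => (h 0).1)
      (fun k u v h => h.forth hx) (fun k u v h b => by
        obtain ⟨d, hd⟩ := h.symm.forth hx b
        exact ⟨d, hd.symm⟩) h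
    refine ⟨σ, fun i t => ?_, funext fun i => (h1 i).symm⟩
    obtain ⟨k', u', v', hR, s, hs, hs'⟩ := h2 _ t
    change x i (σ ∘ t) = x i t
    rw [hs', hs]
    exact ((hR 0).2 i s).symm
  · intro h m
    exact (BF.refl x m k u).orb h

end Orbits

section Invariant

variable {a : ℕ → ℕ}

/-- index set of the invariant -/
abbrev Pat := Σ n N : ℕ, Set (Σ k : Fin (n + 1), (Fin k → Fin N) × (Fin k → Fin N))

/-- `t` represents all types of tuples of length at most `n`. -/
def Complete (x : Codes a) (n : ℕ) {N : ℕ} (t : Fin N → ℕ) : Prop :=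
  ∀ (k : Fin (n + 1)) (u : Fin k → ℕ), ∃ p : Fin k → Fin N, ET x (t ∘ p) u

/-- the invariant -/
def PatInv (x : Codes a) (P : Pat) : Prop :=
  ∃ t : Fin P.2.1 → ℕ, Complete x P.1 t ∧
    ∀ (k : Fin (P.1 + 1)) (p q : Fin k → Fin P.2.1), (⟨k, p, q⟩ ∈ P.2.2) ↔ ET x (t ∘ p) (t ∘ q)

theorem exists_complete {x : Codes a} (hx : OmegaCatX x) (n : ℕ) :
    ∃ (N : ℕ) (t : Fin N → ℕ), Complete x n t := by
  choose N hN using oligo_bound hx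
  refine ⟨(Finset.range (n + 1)).sup N, fun i => i, fun k u => ?_⟩
  obtain ⟨p, hp⟩ := hN k u ((Finset.range (n + 1)).sup N)
    (Finset.le_sup (f := N) (Finset.mem_range.2 k.2))
  exact ⟨p, (et_iff_orb hx _ _).2 hp⟩

theorem orb_conj {x y : Codes a} {σ : Equiv.Perm ℕ}
    (h : ∀ g, g ∈ AutX x → σ * g * σ⁻¹ ∈ AutX y) {k : ℕ} {u v : Fin k → ℕ} (huv : Orb x u v) :
    Orb y (σ ∘ u) (σ ∘ v) := by
  obtain ⟨g, hg, rfl⟩ := huv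
  exact ⟨_, h g hg, by funext i; simp⟩

theorem conj_symm {x y : Codes a} {σ : Equiv.Perm ℕ}
    (h : ∀ g, g ∈ AutX x ↔ σ * g * σ⁻¹ ∈ AutX y) :
    ∀ g, g ∈ AutX y ↔ σ⁻¹ * g * σ⁻¹⁻¹ ∈ AutX x := by
  intro g
  rw [h]
  have : σ * (σ⁻¹ * g * σ⁻¹⁻¹) * σ⁻¹ = g := by group
  rw [this]

theorem inv_of_conj {x y : Codes a} (hx : OmegaCatX x) (hy : OmegaCatX y) {σ : Equiv.Perm ℕ}
    (h : ∀ g, g ∈ AutX x ↔ σ * g * σ⁻¹ ∈ AutX y) (P : Pat) (hP : PatInv x P) : PatInv y P := by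
  obtain ⟨t, h1, h2⟩ := hP
  refine ⟨σ ∘ t, fun k u => ?_, fun k p q => ?_⟩
  · obtain ⟨p, hp⟩ := h1 k (⇑σ⁻¹ ∘ u)
    refine ⟨p, ?_⟩
    rw [et_iff_orb hx] at hp
    rw [et_iff_orb hy]
    have := orb_conj (fun g => (h g).1) hp
    rw [← Function.comp_assoc] at this
    have e : σ ∘ (⇑σ⁻¹ ∘ u) = u := by funext i; simp
    rwa [e] at this
  · rw [h2, et_iff_orb hx, et_iff_orb hy]
    constructor
    · exact fun h' => orb_conj (fun g => (h g).1) h'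
    · intro h'
      have := orb_conj (fun g => (conj_symm h g).1) h'
      have e : ∀ r : Fin k → Fin P.2.1, ⇑σ⁻¹ ∘ ((σ ∘ t) ∘ r) = t ∘ r := fun r => by
        funext i; simp
      rwa [e, e] at this

/-- correspondence of tuples along `t, t'` -/
def Cor (x y : Codes a) {N : ℕ} (t t' : Fin N → ℕ) {k : ℕ} (u v : Fin k → ℕ) : Prop :=
  ∃ p : Fin k → Fin N, Orb x (t ∘ p) u ∧ Orb y (t' ∘ p) v

theorem Cor.swap {x y : Codes a} {N : ℕ} {t t' : Fin N → ℕ} {k : ℕ} {u v : Fin k → ℕ}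
    (h : Cor x y t t' u v) : Cor y x t' t v u := by
  obtain ⟨p, h1, h2⟩ := h
  exact ⟨p, h2, h1⟩

theorem Cor.comp {x y : Codes a} {N : ℕ} {t t' : Fin N → ℕ} {k j : ℕ} {u v : Fin k → ℕ}
    (h : Cor x y t t' u v) (s : Fin j → Fin k) : Cor x y t t' (u ∘ s) (v ∘ s) := by
  obtain ⟨p, h1, h2⟩ := h
  exact ⟨p ∘ s, h1.comp s, h2.comp s⟩

theorem Cor.inv {x y : Codes a} {N : ℕ} {t t' : Fin N → ℕ} {k : ℕ} {u v u' v' : Fin k → ℕ}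
    (h : Cor x y t t' u v) (hu : Orb x u u') (hv : Orb y v v') : Cor x y t t' u' v' := by
  obtain ⟨p, h1, h2⟩ := h
  exact ⟨p, h1.trans hu, h2.trans hv⟩

/-- `t` and `t'` have the same complete pattern up to level `n`. -/
def Match (x y : Codes a) (n : ℕ) {N : ℕ} (t t' : Fin N → ℕ) : Prop :=
  (∀ k ≤ n, ∀ u : Fin k → ℕ, ∃ p : Fin k → Fin N, Orb x (t ∘ p) u) ∧
  (∀ k ≤ n, ∀ u : Fin k → ℕ, ∃ p : Fin k → Fin N, Orb y (t' ∘ p) u) ∧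
  (∀ k ≤ n, ∀ p q : Fin k → Fin N, Orb x (t ∘ p) (t ∘ q) ↔ Orb y (t' ∘ p) (t' ∘ q))

theorem Match.swap {x y : Codes a} {n N : ℕ} {t t' : Fin N → ℕ} (h : Match x y n t t') :
    Match y x n t' t := ⟨h.2.1, h.1, fun k hk p q => (h.2.2 k hk p q).symm⟩

theorem Match.uniq {x y : Codes a} {n N : ℕ} {t t' : Fin N → ℕ} (h : Match x y n t t')
    {k : ℕ} (hk : k ≤ n) {u v v' : Fin k → ℕ} (h1 : Cor x y t t' u v) (h2 : Cor x y t t' u v') :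
    Orb y v v' := by
  obtain ⟨p, hp1, hp2⟩ := h1
  obtain ⟨q, hq1, hq2⟩ := h2
  exact (hp2.symm.trans ((h.2.2 k hk p q).1 (hp1.trans hq1.symm))).trans hq2

theorem Match.eq {x y : Codes a} {n N : ℕ} {t t' : Fin N → ℕ} (h : Match x y n t t')
    {k : ℕ} (hk : k ≤ n) {u v : Fin k → ℕ} (h1 : Cor x y t t' u v) {i j : Fin k}
    (hij : u i = u j) : v i = v j := by
  classical
  let s : Fin k → Fin k := Function.update id j i
  have hs : u ∘ s = u := by
    funext l
    by_cases hl : l = j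
    · subst hl; simp [s, hij]
    · simp [s, hl]
  have h2 := h1.comp s
  rw [hs] at h2
  obtain ⟨g, hg, hv⟩ := h.uniq hk h1 h2
  apply g.injective
  have e1 := congrFun hv i
  have e2 := congrFun hv j
  have e3 : s j = i := by simp [s]
  have e4 : s i = i := by
    by_cases hl : i = j
    · subst hl; exact e3
    · simp [s, hl]
  simp only [Function.comp_apply, e3, e4] at e1 e2
  rw [← e1, ← e2]

theorem exists_match {x y : Codes a} (hx : OmegaCatX x) (hy : OmegaCatX y)
    (h : ∀ P, PatInv x P ↔ PatInv y P) (n : ℕ) : ∃ (N : ℕ) (t t' : Fin N → ℕ), Match x y n t t' := by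
  obtain ⟨N, t, ht⟩ := exists_complete hx n
  let E : Set (Σ k : Fin (n + 1), (Fin k → Fin N) × (Fin k → Fin N)) :=
    {z | ET x (t ∘ z.2.1) (t ∘ z.2.2)}
  obtain ⟨t', h1, h2⟩ := (h ⟨n, N, E⟩).1 ⟨t, ht, fun k p q => Iff.rfl⟩
  refine ⟨N, t, t', fun k hk u => ?_, fun k hk u => ?_, fun k hk p q => ?_⟩
  · obtain ⟨p, hp⟩ := ht ⟨k, Nat.lt_succ_of_le hk⟩ u
    exact ⟨p, (et_iff_orb hx _ _).1 hp⟩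
  · obtain ⟨p, hp⟩ := h1 ⟨k, Nat.lt_succ_of_le hk⟩ u
    exact ⟨p, (et_iff_orb hy _ _).1 hp⟩
  · rw [← et_iff_orb hx, ← et_iff_orb hy]
    exact h2 ⟨k, Nat.lt_succ_of_le hk⟩ p q

theorem hyper_ge (m : ℕ) : ∀ᶠ n in (Filter.hyperfilter ℕ : Filter ℕ), m ≤ n := by
  have := Filter.eventually_ge_atTop m
  rw [← Nat.cofinite_eq_atTop] at this
  exact Filter.hyperfilter_le_cofinite this

/-- limit correspondence -/
def Lim (x y : Codes a) (N : ℕ → ℕ) (t t' : ∀ n, Fin (N n) → ℕ) (k : ℕ) (u v : Fin k → ℕ) : Prop :=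
  ∀ᶠ n in (Filter.hyperfilter ℕ : Filter ℕ), Cor x y (t n) (t' n) u v

theorem Lim.swap {x y : Codes a} {N : ℕ → ℕ} {t t' : ∀ n, Fin (N n) → ℕ} {k : ℕ} {u v : Fin k → ℕ}
    (h : Lim x y N t t' k u v) : Lim y x N t' t k v u := h.mono fun _ h => h.swap

theorem Lim.uniq {x y : Codes a} {N : ℕ → ℕ} {t t' : ∀ n, Fin (N n) → ℕ}
    (hm : ∀ n, Match x y n (t n) (t' n)) {k : ℕ} {u v v' : Fin k → ℕ}
    (h : Lim x y N t t' k u v) (h' : Lim x y N t t' k u v') : Orb y v v' := by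
  obtain ⟨n, ⟨h1, h2⟩, hn⟩ := ((h.and h').and (hyper_ge k)).exists
  exact (hm n).uniq hn h1 h2

theorem Lim.ex {x y : Codes a} (hy : OmegaCatX y) {N : ℕ → ℕ} {t t' : ∀ n, Fin (N n) → ℕ}
    (hm : ∀ n, Match x y n (t n) (t' n)) {k : ℕ} (u : Fin k → ℕ) :
    ∃ v, Lim x y N t t' k u v := by
  obtain ⟨M, hM⟩ := oligo_bound hy k
  have h : ∀ᶠ n in (Filter.hyperfilter ℕ : Filter ℕ), ∃ w : Fin k → Fin M,
      Cor x y (t n) (t' n) u (fun i => (w i : ℕ)) := by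
    filter_upwards [hyper_ge k] with n hn
    obtain ⟨p, hp⟩ := (hm n).1 k hn u
    obtain ⟨w, hw⟩ := hM (t' n ∘ p) M le_rfl
    exact ⟨w, p, hp, hw.symm⟩
  rw [Ultrafilter.eventually_exists_iff] at h
  obtain ⟨w, hw⟩ := h
  exact ⟨_, hw⟩

theorem Lim.forth {x y : Codes a} (hy : OmegaCatX y) {N : ℕ → ℕ} {t t' : ∀ n, Fin (N n) → ℕ}
    (hm : ∀ n, Match x y n (t n) (t' n)) {k : ℕ} {u v : Fin k → ℕ}
    (h : Lim x y N t t' k u v) (c : ℕ) :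
    ∃ d, Lim x y N t t' (k + 1) (Fin.snoc u c) (Fin.snoc v d) := by
  obtain ⟨w, hw⟩ := Lim.ex hy hm (Fin.snoc u c : Fin (k + 1) → ℕ)
  have h1 : Lim x y N t t' k u (w ∘ Fin.castSucc) := hw.mono fun n hn => by
    have := hn.comp Fin.castSucc
    have e : (Fin.snoc u c : Fin (k + 1) → ℕ) ∘ Fin.castSucc = u := by
      funext i; simp
    rwa [e] at this
  obtain ⟨g, hg, hv⟩ := Lim.uniq hm h1 h
  refine ⟨g (w (Fin.last k)), hw.mono fun n hn => hn.inv (Orb.refl _ _) ⟨g, hg, ?_⟩⟩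
  subst hv
  funext i
  refine Fin.lastCases ?_ (fun i => ?_) i <;> simp

theorem conj_of_inv {x y : Codes a} (hx : OmegaCatX x) (hy : OmegaCatX y)
    (h : ∀ P, PatInv x P ↔ PatInv y P) :
    ∃ σ : Equiv.Perm ℕ, ∀ g, g ∈ AutX x ↔ σ * g * σ⁻¹ ∈ AutX y := by
  choose N t t' hm using exists_match hx hy h
  have hm' : ∀ n, Match y x n (t' n) (t n) := fun n => (hm n).swap
  obtain ⟨w, hw⟩ := Lim.ex hy hm (Fin.elim0 : Fin 0 → ℕ)
  obtain ⟨σ, -, hσ⟩ := bf_tuples (Lim x y N t t')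
    (fun k u v h i j => by
      obtain ⟨n, h1, hn⟩ := (h.and (hyper_ge k)).exists
      exact ⟨fun e => (hm n).eq hn h1 e, fun e => (hm' n).eq hn h1.swap e⟩)
    (fun k u v h => h.forth hy hm)
    (fun k u v h b => by
      obtain ⟨c, hc⟩ := h.swap.forth hx hm' b
      exact ⟨c, hc.swap⟩) hw
  have hR : ∀ (k : ℕ) (u : Fin k → ℕ), Lim x y N t t' k u (σ ∘ u) := by
    intro k u
    obtain ⟨k', u', v', h1, s, hs, hs'⟩ := hσ k u
    rw [hs', hs]
    exact h1.mono fun n hn => hn.comp s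
  refine ⟨σ, fun g => ⟨fun hg i r => ?_, fun hg i r => ?_⟩⟩
  · have h1 := hR _ (⇑σ⁻¹ ∘ r)
    have h2 := hR _ (g ∘ ⇑σ⁻¹ ∘ r)
    have h3 : Lim x y N t t' _ (⇑σ⁻¹ ∘ r) (σ ∘ g ∘ ⇑σ⁻¹ ∘ r) :=
      h2.mono fun n hn => hn.inv (Orb.symm ⟨g, hg, rfl⟩) (Orb.refl _ _)
    obtain ⟨k, hk, e⟩ := Lim.uniq hm h1 h3
    have e1 : σ ∘ ⇑σ⁻¹ ∘ r = r := by funext i; simp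
    rw [e1] at e
    change y i (σ ∘ g ∘ ⇑σ⁻¹ ∘ r) = y i r
    rw [e]
    exact hk i r
  · have h1 := (hR _ r).swap
    have h2 := (hR _ (g ∘ r)).swap
    have h3 : Lim y x N t' t _ (σ ∘ r) (g ∘ r) :=
      h2.mono fun n hn => hn.inv (Orb.symm ⟨_, hg, by funext i; simp⟩) (Orb.refl _ _)
    obtain ⟨k, hk, e⟩ := Lim.uniq hm' h1 h3
    change x i (g ∘ r) = x i r
    rw [e]
    exact hk i r

theorem end_conj {x y : Codes a} (hx : MCCoreX x) {σ : Equiv.Perm ℕ}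
    (h : ∀ g, g ∈ AutX x ↔ σ * g * σ⁻¹ ∈ AutX y) (e : ℕ → ℕ) (he : e ∈ EndX x) :
    (σ ∘ e ∘ ⇑σ⁻¹ : ℕ → ℕ) ∈ EndX y := by
  intro i t ht
  obtain ⟨g, hg, hge⟩ := hx e he (Finset.univ.image (⇑σ⁻¹ ∘ t))
  have h1 := (h g).1 hg i t
  have h2 : (fun j => (σ * g * σ⁻¹) (t j)) = fun j => (σ ∘ e ∘ ⇑σ⁻¹) (t j) := by
    funext j
    have := hge ((⇑σ⁻¹ ∘ t) j) (by simp)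
    simpa using this
  rw [h2, ht] at h1
  exact h1

theorem conj_continuous {x y : Codes a} (σ : Equiv.Perm ℕ) (F : EndX x → EndX y)
    (hF : ∀ e, (F e).1 = (σ ∘ e.1 ∘ ⇑σ⁻¹ : ℕ → ℕ)) :
    @Continuous _ _ (endXTop x) (endXTop y) F := by
  let t1 := endXTop x
  let t0 : TopologicalSpace ℕ := ⊥
  have : DiscreteTopology ℕ := ⟨rfl⟩
  refine continuous_induced_rng.2 ?_
  refine (@continuous_pi_iff _ ℕ (fun _ => ℕ) _ (fun _ => ⊥) _).2 fun n => ?_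
  have h1 : @Continuous (EndX x) (ℕ → ℕ) (endXTop x) Pi.topologicalSpace (fun e => e.1) :=
    continuous_induced_dom
  have h2 : Continuous fun e : EndX x => σ (e.1 (σ⁻¹ n)) :=
    (continuous_of_discreteTopology (f := σ)).comp
      ((continuous_apply (A := fun _ : ℕ => ℕ) (σ⁻¹ n)).comp h1)
  convert h2 using 2 with e
  exact congrFun (hF e) n

theorem epBiInt_of_conj {x y : Codes a} (hx : MCCoreX x) (hy : MCCoreX y) {σ : Equiv.Perm ℕ}
    (h : ∀ g, g ∈ AutX x ↔ σ * g * σ⁻¹ ∈ AutX y) : EpBiInt x y := by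
  let φ : EndX x ≃* EndX y :=
    { toFun := fun e => ⟨(σ ∘ e.1 ∘ ⇑σ⁻¹ : ℕ → ℕ), end_conj hx h e.1 e.2⟩
      invFun := fun e => ⟨(⇑σ⁻¹ ∘ e.1 ∘ ⇑σ⁻¹⁻¹ : ℕ → ℕ), end_conj hy (conj_symm h) e.1 e.2⟩
      left_inv := fun e => by
        apply Subtype.ext; funext n
        change σ⁻¹ (σ (e.1 (σ⁻¹ (σ n)))) = e.1 n
        simp
      right_inv := fun e => by
        apply Subtype.ext; funext n
        change σ (σ⁻¹ (e.1 (σ (σ⁻¹ n)))) = e.1 n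
        simp
      map_mul' := fun e f => by
        apply Subtype.ext; funext n
        change σ (e.1 (f.1 (σ⁻¹ n))) = σ (e.1 (σ⁻¹ (σ (f.1 (σ⁻¹ n)))))
        simp }
  exact ⟨φ, conj_continuous σ _ fun _ => rfl, conj_continuous σ⁻¹ _ fun _ => rfl⟩

theorem measurable_BF [MeasurableSpace (Codes a)]
    (hev : ∀ i t, Measurable fun x : Codes a => x i t) (m k : ℕ) (u v : Fin k → ℕ) :
    Measurable fun x : Codes a => BF x m k u v := by
  induction m generalizing k with
  | zero =>
    refine Measurable.and measurable_const ?_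
    refine Measurable.forall fun i => Measurable.forall fun s => ?_
    exact measurableSet_setOfPred.1 (measurableSet_eq_fun (hev _ _) (hev _ _))
  | succ m ih =>
    refine (ih _ _ _).and (Measurable.and ?_ ?_)
    · exact Measurable.forall fun c => Measurable.exists fun d => ih _ _ _
    · exact Measurable.forall fun c => Measurable.exists fun d => ih _ _ _

theorem measurable_PatInv [MeasurableSpace (Codes a)]
    (hev : ∀ i t, Measurable fun x : Codes a => x i t) (P : Pat) :
    Measurable fun x : Codes a => PatInv x P := by
  have hET : ∀ (k : ℕ) (u v : Fin k → ℕ), Measurable fun x : Codes a => ET x u v :=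
    fun k u v => Measurable.forall fun m => measurable_BF hev m k u v
  refine Measurable.exists fun t => Measurable.and ?_ ?_
  · exact Measurable.forall fun k => Measurable.forall fun u => Measurable.exists fun p =>
      hET _ _ _
  · exact Measurable.forall fun k => Measurable.forall fun p => Measurable.forall fun q =>
      Measurable.iff measurable_const (hET _ _ _)

theorem measurable_eval (i : ℕ) (t : Fin (a i) → ℕ) :
    @Measurable (Codes a) Bool (@borel (Codes a) (XTop a)) _ fun x => x i t := by
  let t1 : TopologicalSpace (Codes a) := XTop a
  let m1 : MeasurableSpace (Codes a) := borel (Codes a)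
  have : BorelSpace (Codes a) := ⟨rfl⟩
  have hc : Continuous fun x : Codes a => x i t := by
    have h1 : @Continuous (Codes a) _ (XTop a) Pi.topologicalSpace fun x : Codes a => x i :=
      continuous_apply (A := fun i => (Fin (a i) → ℕ) → Bool) i
    exact (continuous_apply (A := fun _ : Fin (a i) → ℕ => Bool) t).comp h1
  exact hc.measurable

end Invariant

/-- ep-bi-interpretability is a smooth equivalence relation on the class of
ω-categorical model-complete cores without algebraicity. -/
theorem epBiInterpretability_smooth (a : ℕ → ℕ) :
    ∃ f : Codes a → ℝ,
      @Measurable (Codes a) ℝ (@borel (Codes a) (XTop a)) Real.measurableSpace f ∧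
      ∀ x y : Codes a,
        OmegaCatX x → MCCoreX x → NoAlgX x →
        OmegaCatX y → MCCoreX y → NoAlgX y →
        (EpBiInt x y ↔ f x = f y) := by
  classical
  let m1 : MeasurableSpace (Codes a) := @borel (Codes a) (XTop a)
  refine ⟨fun x => MeasureTheory.embeddingReal (Pat → Prop) (PatInv x), ?_, ?_⟩
  · exact (MeasureTheory.measurableEmbedding_embeddingReal (Pat → Prop)).measurable.comp
      (measurable_pi_iff.2 fun P => measurable_PatInv measurable_eval P)
  · intro x y hx hx' hx'' hy hy' hy''
    rw [(MeasureTheory.measurableEmbedding_embeddingReal (Pat → Prop)).injective.eq_iff]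
    constructor
    · intro h
      obtain ⟨σ, hσ⟩ := conj_of_epBiInt hx'' hy'' h
      funext P
      exact propext ⟨inv_of_conj hx hy hσ P, inv_of_conj hy hx (conj_symm hσ) P⟩
    · intro h
      obtain ⟨σ, hσ⟩ := conj_of_inv hx hy (fun P => by rw [h])
      exact epBiInt_of_conj hx' hy' hσ
end
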